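/- arXiv:1007.3007 — 4 statements merged into one kernel-verified Lean document; each statement's English description precedes it below -/
import Mathlib

section
/- Let N ≥ 1 and let p satisfy 2 < p < 2N/(N−2) if N ≥ 3 and 2 < p < ∞ if N ∈ {1,2}. Let B = (β_ij) be a symmetric n×n real matrix with β_ii ≥ 0 for every i, which is NOT strictly copositive. Then the system −Δu_i = ∑_{j=1}^n β_ij u_j^{p/2} u_i^{p/2−1} (i = 1,…,n) admits a nontrivial solution on ℝ^N: there exist C² functions u₁,…,uₙ : ℝ^N → ℝ with u_i ≥ 0, solving the system on ℝ^N, and u_i ≢ 0 for at least one i. -/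
open Finset

/-- The Laplacian of a function `f : ℝ^N → ℝ`: the sum of the second partial
derivatives in the coordinate directions. -/
noncomputable def laplacian {N : ℕ} (f : (Fin N → ℝ) → ℝ) (x : Fin N → ℝ) : ℝ :=
  ∑ i : Fin N, fderiv ℝ (fun y => fderiv ℝ f y (Pi.single i 1)) x (Pi.single i 1)

open Finset

namespace LV

def skp (j i : ℕ) : ℕ := if i < j then i else i + 1

def pr (n j t : ℕ) (w : ℕ → ℕ → ℕ) : ℕ → ℕ → ℕ := fun i =>
  if i ≤ j then Function.update (w i) n t else Function.update (w (i - 1)) n (t + 1)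

def dlt (m : ℕ) (c : (ℕ → ℕ → ℕ) → ZMod 2) (w : ℕ → ℕ → ℕ) : ZMod 2 :=
  ∑ j ∈ range (m + 1), c (fun i => w (skp j i))

def hh (n m t : ℕ) (c : (ℕ → ℕ → ℕ) → ZMod 2) (w : ℕ → ℕ → ℕ) : ZMod 2 :=
  ∑ j ∈ range m, c (pr n j t w)

def II (N : ℕ) : ℕ → ((ℕ → ℕ → ℕ) → ZMod 2) → ZMod 2
  | 0, c => c (fun _ _ => 0)
  | n + 1, c => ∑ t ∈ range N, II N n (hh n (n + 1) t c)

lemma II_add (N n : ℕ) : ∀ c c' : (ℕ → ℕ → ℕ) → ZMod 2,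
    II N n (fun w => c w + c' w) = II N n c + II N n c' := by
  induction n with
  | zero => intro c c'; rfl
  | succ n ih =>
    intro c c'
    simp only [II]
    rw [← sum_add_distrib]
    refine sum_congr rfl fun t _ => ?_
    rw [← ih]
    congr 1
    funext w
    simp only [hh, sum_add_distrib]

lemma II_vanish (N n : ℕ) : ∀ c : (ℕ → ℕ → ℕ) → ZMod 2,
    (∀ w : ℕ → ℕ → ℕ, (∃ x : ℕ → ℕ, (∀ i < n, x i < N) ∧
      ∀ j, ∀ i < n, x i ≤ w j i ∧ w j i ≤ x i + 1) → c w = 0) → II N n c = 0 := by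
  induction n with
  | zero => intro c h; exact h _ ⟨fun _ => 0, by simp, by simp⟩
  | succ n ih =>
    intro c h
    simp only [II]
    refine sum_eq_zero fun t ht => ih _ fun w hw => ?_
    obtain ⟨x, hx, hw⟩ := hw
    refine sum_eq_zero fun j _ => h _ ⟨Function.update x n t, ?_, ?_⟩
    · intro i hi
      rcases eq_or_ne i n with rfl | hne
      · simpa using ht
      · rw [Function.update_of_ne hne]; exact hx i (by omega)
    · intro l i hi
      rcases eq_or_ne i n with rfl | hne
      · simp only [pr]; split_ifs <;> simp
      · rw [Function.update_of_ne hne]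
        simp only [pr]
        split_ifs <;> rw [Function.update_of_ne hne] <;> exact hw _ i (by omega)

lemma z2 (a : ZMod 2) : a + a = 0 := CharTwo.add_self_eq_zero a

lemma prism (n m t : ℕ) (c : (ℕ → ℕ → ℕ) → ZMod 2)
    (hc : ∀ w w' : ℕ → ℕ → ℕ, (∀ i ≤ m, w i = w' i) → c w = c w') (w : ℕ → ℕ → ℕ) :
    hh n (m + 1) t (dlt (m + 1) c) w =
      c (fun i => Function.update (w i) n t) + c (fun i => Function.update (w i) n (t + 1))
      + dlt m (hh n m t c) w := by
  set E : ℕ → ZMod 2 := fun j =>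
    c (fun l => if l < j then Function.update (w l) n t else Function.update (w l) n (t + 1)) with hE
  set Bf : ℕ → ℕ → ZMod 2 := fun i j => c (pr n j t (fun l => w (skp i l))) with hB
  have e1 : ∀ i j, i ≤ j → c (fun l => pr n (j + 1) t w (skp i l)) = Bf i j := by
    intro i j h
    simp only [hB]
    congr 1
    funext l
    simp only [pr, skp]
    split_ifs <;> first | rfl | omega | (congr 2; omega)
  have e2 : ∀ i j, j < i → c (fun l => pr n j t w (skp (i + 1) l)) = Bf i j := by
    intro i j h
    simp only [hB]
    congr 1
    funext l
    simp only [pr, skp]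
    split_ifs <;> first | rfl | omega | (congr 2; omega)
  have e3 : ∀ j, c (fun l => pr n j t w (skp j l)) = E j := by
    intro j
    simp only [hE]
    congr 1
    funext l
    simp only [pr, skp]
    split_ifs <;> first | rfl | omega
  have e4 : ∀ j, c (fun l => pr n j t w (skp (j + 1) l)) = E (j + 1) := by
    intro j
    simp only [hE]
    congr 1
    funext l
    simp only [pr, skp]
    split_ifs <;> first | rfl | omega | (congr 2; omega)
  have key : ∀ j ∈ range (m + 1), dlt (m + 1) c (pr n j t w) =
      (E (j + 1) - E j) + ((∑ i ∈ range j, c (fun l => pr n j t w (skp i l)))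
        + ∑ i ∈ Ico (j + 1) (m + 1), Bf i j) := by
    intro j hj
    have hj : j < m + 1 := by simpa using hj
    have h1 : ∑ i ∈ Ico (j + 1) (m + 1), Bf i j
        = ∑ i ∈ Ico (j + 2) (m + 2), c (fun l => pr n j t w (skp i l)) := by
      rw [← sum_Ico_add' (fun i => c (fun l => pr n j t w (skp i l))) (j + 1) (m + 1) 1]
      refine sum_congr rfl fun i hi => (e2 i j ?_).symm
      simp at hi; omega
    rw [h1]
    unfold dlt
    rw [range_eq_Ico, ← sum_Ico_consecutive _ (Nat.zero_le j) (show j ≤ m + 2 by omega),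
      sum_eq_sum_Ico_succ_bot (show j < m + 2 by omega),
      sum_eq_sum_Ico_succ_bot (show j + 1 < m + 2 by omega), e3, e4, CharTwo.sub_eq_add,
      range_eq_Ico]
    ring
  unfold hh
  rw [sum_congr rfl key, sum_add_distrib, sum_range_sub, sum_add_distrib]
  have h1 : ∑ j ∈ range (m + 1), ∑ i ∈ range j, c (fun l => pr n j t w (skp i l))
      = ∑ j ∈ range m, ∑ i ∈ range (j + 1), Bf i j := by
    rw [sum_range_succ']
    simp only [range_zero, sum_empty, add_zero]
    refine sum_congr rfl fun j _ => sum_congr rfl fun i hi => e1 i j ?_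
    simp at hi; omega
  have h2 : ∑ j ∈ range (m + 1), ∑ i ∈ Ico (j + 1) (m + 1), Bf i j
      = ∑ j ∈ range m, ∑ i ∈ Ico (j + 1) (m + 1), Bf i j := by
    rw [sum_range_succ]; simp
  have h3 : ∑ j ∈ range m, ∑ i ∈ range (j + 1), Bf i j
      + ∑ j ∈ range m, ∑ i ∈ Ico (j + 1) (m + 1), Bf i j = dlt m (hh n m t c) w := by
    rw [← sum_add_distrib]
    unfold dlt hh
    rw [sum_comm]
    refine sum_congr rfl fun j hj => ?_
    have hj : j < m := by simpa using hj
    rw [range_eq_Ico, sum_Ico_consecutive _ (by omega) (by omega), range_eq_Ico]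
  rw [h1, h2, h3, CharTwo.sub_eq_add]
  have h4 : E (m + 1) = c (fun i => Function.update (w i) n t) := by
    simp only [hE]
    apply hc
    intro i hi
    simp [Nat.lt_succ_of_le hi]
  have h5 : E 0 = c (fun i => Function.update (w i) n (t + 1)) := by
    simp [hE]
  rw [h4, h5]
  rfl

lemma stokes_step (N n : ℕ)
    (ih : ∀ c : (ℕ → ℕ → ℕ) → ZMod 2, (∀ w w' : ℕ → ℕ → ℕ, (∀ i < n, w i = w' i) → c w = c w') →
      (n = 0 → ∀ w, c w = 0) →
      (∀ i < n, ∀ w : ℕ → ℕ → ℕ, ((∀ j, w j i = 0) ∨ (∀ j, w j i = N)) → c w = 0) →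
      II N n (dlt n c) = 0)
    (c : (ℕ → ℕ → ℕ) → ZMod 2) (hc : ∀ w w' : ℕ → ℕ → ℕ, (∀ i ≤ n, w i = w' i) → c w = c w')
    (hf : ∀ i < n, ∀ w : ℕ → ℕ → ℕ, ((∀ j, w j i = 0) ∨ (∀ j, w j i = N)) → c w = 0) :
    II N (n + 1) (dlt (n + 1) c) = II N n (fun w => c (fun i => Function.update (w i) n 0))
      + II N n (fun w => c (fun i => Function.update (w i) n N)) := by
  simp only [II]
  have key : ∀ t ∈ range N, II N n (hh n (n + 1) t (dlt (n + 1) c)) =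
      II N n (fun w => c (fun i => Function.update (w i) n (t + 1)))
      - II N n (fun w => c (fun i => Function.update (w i) n t)) := by
    intro t _
    rw [show hh n (n + 1) t (dlt (n + 1) c) = fun w => 
      (c (fun i => Function.update (w i) n t) + c (fun i => Function.update (w i) n (t + 1)))
      + dlt n (hh n n t c) w from funext fun w => prism n n t c hc w]
    rw [II_add, II_add, ih (hh n n t c), CharTwo.sub_eq_add]
    · ring
    · intro w w' h
      refine sum_congr rfl fun j hj => hc _ _ fun i hi => ?_
      have hj : j < n := by simpa using hj
      simp only [pr]
      split_ifs
      · rw [h i (by omega)]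
      · rw [h (i - 1) (by omega)]
    · rintro rfl w
      simp [hh]
    · intro i hi w h
      refine sum_eq_zero fun j _ => hf i hi _ ?_
      have hne : i ≠ n := by omega
      rcases h with h | h
      · left; intro l; simp only [pr]; split_ifs <;> rw [Function.update_of_ne hne, h]
      · right; intro l; simp only [pr]; split_ifs <;> rw [Function.update_of_ne hne, h]
  rw [sum_congr rfl key, sum_range_sub (fun t => II N n (fun w => c (fun i => Function.update (w i) n t))),
    CharTwo.sub_eq_add]
  ring

lemma II_zero (N n : ℕ) : II N n (fun _ => 0) = 0 := II_vanish N n _ fun _ _ => rfl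

lemma stokes (N n : ℕ) : ∀ c : (ℕ → ℕ → ℕ) → ZMod 2,
      (∀ w w' : ℕ → ℕ → ℕ, (∀ i < n, w i = w' i) → c w = c w') →
      (n = 0 → ∀ w, c w = 0) →
      (∀ i < n, ∀ w : ℕ → ℕ → ℕ, ((∀ j, w j i = 0) ∨ (∀ j, w j i = N)) → c w = 0) →
      II N n (dlt n c) = 0 := by
  induction n with
  | zero => intro c _ h _; simp [II, dlt, h]
  | succ n ih =>
    intro c hc _ hf
    rw [stokes_step N n ih c (fun w w' h => hc w w' fun i hi => h i (by omega))
      (fun i hi => hf i (by omega))]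
    have h1 : (fun w : ℕ → ℕ → ℕ => c (fun i => Function.update (w i) n 0)) = fun _ => 0 :=
      funext fun w => hf n (by omega) _ (Or.inl fun j => by simp)
    have h2 : (fun w : ℕ → ℕ → ℕ => c (fun i => Function.update (w i) n N)) = fun _ => 0 :=
      funext fun w => hf n (by omega) _ (Or.inr fun j => by simp)
    rw [h1, h2, II_zero, add_zero]

def PP (a : ℕ → (ℕ → ℕ) → ZMod 2) (n : ℕ) (w : ℕ → ℕ → ℕ) : ZMod 2 :=
  ∏ k ∈ range n, (a k (w (k + 1)) + a k (w k))

lemma PP_skp (a : ℕ → (ℕ → ℕ) → ZMod 2) (n m : ℕ) (h : n < m) (w : ℕ → ℕ → ℕ) :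
    PP a n (fun i => w (skp m i)) = PP a n w := by
  refine prod_congr rfl fun k hk => ?_
  have hk : k < n := by simpa using hk
  simp [skp, show k + 1 < m by omega, show k < m by omega]

lemma PP_cocycle (a : ℕ → (ℕ → ℕ) → ZMod 2) (n : ℕ) (w : ℕ → ℕ → ℕ) :
    dlt (n + 1) (PP a n) w = 0 := by
  induction n with
  | zero => simp [dlt, PP]; rfl
  | succ n ih =>
    unfold dlt at ih ⊢
    rw [sum_range_succ, PP_skp a n _ (by omega)] at ih
    have ih' : ∑ j ∈ range (n + 1), PP a n (fun i => w (skp j i)) = PP a n w := by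
      rwa [CharTwo.add_eq_zero] at ih
    have h0 : ∀ u, PP a (n + 1) u = PP a n u * (a n (u (n + 1)) + a n (u n)) := by
      intro u; simp [PP, prod_range_succ]
    simp only [h0]
    rw [sum_range_succ, sum_range_succ, PP_skp a n (n + 1) (by omega), PP_skp a n (n + 1 + 1) (by omega)]
    have h1 : ∑ j ∈ range (n + 1), PP a n (fun i => w (skp j i)) *
        (a n (w (skp j (n + 1))) + a n (w (skp j n)))
        = PP a n w * (a n (w (n + 2)) + a n (w (n + 1))) := by
      rw [← ih', sum_mul]
      refine sum_congr rfl fun j hj => ?_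
      have hj : j < n + 1 := by simpa using hj
      simp [skp, show ¬ (n + 1 < j) by omega, show ¬ (n < j) by omega]
    rw [h1]
    simp only [skp, lt_irrefl, if_false, Nat.lt_succ_self, if_true, show n < n + 1 + 1 by omega]
    have := z2 (PP a n w * a n (w (n + 2)))
    have := z2 (PP a n w * a n (w (n + 1)))
    have := z2 (PP a n w * a n (w n))
    linear_combination z2 (PP a n w * a n (w (n + 2))) + z2 (PP a n w * a n (w (n + 1))) 
      + z2 (PP a n w * a n (w n))

lemma PP_dlt (a : ℕ → (ℕ → ℕ) → ZMod 2) (n : ℕ) :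
    dlt (n + 1) (fun w => PP a n w * a n (w n)) = PP a (n + 1) := by
  funext w
  have ih := PP_cocycle a n w
  unfold dlt at ih ⊢
  rw [sum_range_succ, PP_skp a n _ (by omega)] at ih
  have ih' : ∑ j ∈ range (n + 1), PP a n (fun i => w (skp j i)) = PP a n w := by
    rwa [CharTwo.add_eq_zero] at ih
  rw [sum_range_succ]
  beta_reduce
  rw [PP_skp a n _ (by omega)]
  have h1 : ∑ j ∈ range (n + 1), PP a n (fun i => w (skp j i)) * a n (w (skp j n))
        = PP a n w * a n (w (n + 1)) := by
    rw [← ih', sum_mul]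
    refine sum_congr rfl fun j hj => ?_
    have hj : j < n + 1 := by simpa using hj
    simp [skp, show ¬ (n < j) by omega]
  rw [h1]
  simp [PP, prod_range_succ, skp]
  ring

lemma II_PP (N n : ℕ) : ∀ a : ℕ → (ℕ → ℕ) → ZMod 2,
    (∀ k < n, ∀ x : ℕ → ℕ, x k = 0 → a k x = 1) →
    (∀ k < n, ∀ x : ℕ → ℕ, x k = N → a k x = 0) → II N n (PP a n) = 1 := by
  induction n with
  | zero => intro a _ _; simp [II, PP]
  | succ n ih =>
    intro a h0 h1
    rw [← PP_dlt, stokes_step N n (stokes N n)]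
    · have e1 : (fun w : ℕ → ℕ → ℕ => PP a n (fun i => Function.update (w i) n 0) * 
          a n (Function.update (w n) n 0)) = PP (fun k x => a k (Function.update x n 0)) n := by
        funext w
        rw [h0 n (by omega) _ (by simp), mul_one]
        rfl
      have e2 : (fun w : ℕ → ℕ → ℕ => PP a n (fun i => Function.update (w i) n N) * 
          a n (Function.update (w n) n N)) = fun _ => 0 := by
        funext w
        rw [h1 n (by omega) _ (by simp), mul_zero]
      rw [e1, e2, II_zero, add_zero]
      apply ih
      · intro k hk x hx
        exact h0 k (by omega) _ (by rw [Function.update_of_ne (by omega), hx])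
      · intro k hk x hx
        exact h1 k (by omega) _ (by rw [Function.update_of_ne (by omega), hx])
    · intro w w' h
      simp only [PP]
      rw [h n le_rfl]
      congr 1
      refine prod_congr rfl fun k hk => ?_
      have hk : k < n := by simpa using hk
      rw [h k (by omega), h (k + 1) (by omega)]
    · intro i hi w h
      have : PP a n w = 0 := by
        refine prod_eq_zero (mem_range.2 hi) ?_
        rcases h with h | h
        · rw [h0 i (by omega) _ (h _), h0 i (by omega) _ (h _)]; rfl
        · rw [h1 i (by omega) _ (h _), h1 i (by omega) _ (h _)]; rfl
      rw [this, zero_mul]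

/-- combinatorial Poincare-Miranda -/
lemma comb_PM (N n : ℕ) (a : ℕ → (ℕ → ℕ) → ZMod 2)
    (h0 : ∀ k < n, ∀ x : ℕ → ℕ, x k = 0 → a k x = 1)
    (h1 : ∀ k < n, ∀ x : ℕ → ℕ, x k = N → a k x = 0) :
    ∃ x : ℕ → ℕ, (∀ i < n, x i < N) ∧ ∀ k < n, ∃ y z : ℕ → ℕ,
      (∀ i < n, x i ≤ y i ∧ y i ≤ x i + 1) ∧ (∀ i < n, x i ≤ z i ∧ z i ≤ x i + 1) ∧
      a k y = 1 ∧ a k z = 0 := by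
  by_contra hcon
  have := II_PP N n a h0 h1
  rw [II_vanish] at this
  · exact zero_ne_one this
  rintro w ⟨x, hx, hw⟩
  by_contra hne
  refine hcon ⟨x, hx, fun k hk => ?_⟩
  have h2 : a k (w (k + 1)) + a k (w k) ≠ 0 := fun h => hne (prod_eq_zero (mem_range.2 hk) h)
  have h3 : ∀ s : ZMod 2, s = 0 ∨ s = 1 := by decide
  rcases h3 (a k (w (k + 1))) with e | e <;> rcases h3 (a k (w k)) with e' | e'
  · rw [e, e'] at h2; simp at h2
  · exact ⟨_, _, hw _, hw _, e', e⟩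
  · exact ⟨_, _, hw _, hw _, e, e'⟩
  · rw [e, e'] at h2; exact absurd (by rfl) h2

theorem poincare_miranda (n : ℕ) (g : (Fin n → ℝ) → Fin n → ℝ) (hg : Continuous g)
    (h0 : ∀ s : Fin n → ℝ, (∀ i, 0 ≤ s i ∧ s i ≤ 1) → ∀ i, s i = 0 → g s i ≤ 0)
    (h1 : ∀ s : Fin n → ℝ, (∀ i, 0 ≤ s i ∧ s i ≤ 1) → ∀ i, s i = 1 → 0 ≤ g s i) :
    ∃ s : Fin n → ℝ, (∀ i, 0 ≤ s i ∧ s i ≤ 1) ∧ g s = 0 := by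
  by_contra hcon
  push Not at hcon
  have hK : IsCompact (Set.Icc (0 : Fin n → ℝ) 1) := isCompact_Icc
  have hmem : ∀ s : Fin n → ℝ, s ∈ Set.Icc (0 : Fin n → ℝ) 1 ↔ ∀ i, 0 ≤ s i ∧ s i ≤ 1 := by
    intro s; simp [Set.mem_Icc, Pi.le_def, forall_and]
  obtain ⟨s0, hs0, hmin⟩ := hK.exists_isMinOn ⟨0, by simp⟩ (hg.norm.continuousOn)
  set η := ‖g s0‖ with hη
  have hηpos : 0 < η := norm_pos_iff.2 (hcon s0 ((hmem _).1 hs0))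
  have huc := hK.uniformContinuousOn_of_continuous hg.continuousOn
  rw [Metric.uniformContinuousOn_iff] at huc
  obtain ⟨δ, hδ, huc⟩ := huc η hηpos
  obtain ⟨N, hN⟩ := exists_nat_gt (1 / δ)
  have hN0 : (0 : ℝ) < N := lt_trans (by positivity) hN
  have hNn : N ≠ 0 := by rintro rfl; simp at hN0
  have hNd : 1 / (N : ℝ) < δ := by
    rw [div_lt_iff₀ hN0]; rw [div_lt_iff₀ hδ] at hN; linarith
  let q : (ℕ → ℕ) → Fin n → ℝ := fun x i => (x i : ℝ) / N
  obtain ⟨x, hx, hx2⟩ := comb_PM N n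
    (fun k x => if h : k < n then
      (if x k = 0 then 1 else if x k = N then 0 else if g (q x) ⟨k, h⟩ < 0 then 1 else 0) else 0)
    (by intro k hk x hx; simp [hk, hx])
    (by intro k hk x hx; simp [hk, hx, hNn])
  have hq : ∀ y : ℕ → ℕ, (∀ i < n, x i ≤ y i ∧ y i ≤ x i + 1) → ∀ i, 0 ≤ q y i ∧ q y i ≤ 1 := by
    intro y hy i
    refine ⟨by positivity, ?_⟩
    simp only [q]
    rw [div_le_one hN0]
    have := hy i i.2
    have := hx i i.2
    exact_mod_cast (by omega : y i ≤ N)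
  have hd : ∀ y : ℕ → ℕ, (∀ i < n, x i ≤ y i ∧ y i ≤ x i + 1) → dist (q y) (q x) < δ := by
    intro y hy
    rw [dist_pi_lt_iff hδ]
    intro i
    have h2 := hy i i.2
    simp only [q]
    rw [Real.dist_eq, ← sub_div, abs_div, abs_of_pos hN0]
    refine lt_of_le_of_lt ?_ hNd
    gcongr
    rw [abs_le]
    have a1 : (x i : ℝ) ≤ y i := by exact_mod_cast h2.1
    have a2 : (y i : ℝ) ≤ x i + 1 := by exact_mod_cast h2.2
    constructor <;> linarith
  have hxx : ∀ i < n, x i ≤ x i ∧ x i ≤ x i + 1 := fun i _ => ⟨le_rfl, by omega⟩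
  have hlt : ‖g (q x)‖ < η := by
    rw [pi_norm_lt_iff hηpos]
    intro k
    obtain ⟨y, z, hy, hz, ay, az⟩ := hx2 k k.2
    have gy : g (q y) k ≤ 0 := by
      simp only [k.2, dif_pos] at ay
      split_ifs at ay with c1 c2 c3
      · exact h0 _ (hq y hy) k (by simp [q, c1])
      · simp at ay
      · exact c3.le
      · simp at ay
    have gz : 0 ≤ g (q z) k := by
      simp only [k.2, dif_pos] at az
      split_ifs at az with c1 c2 c3
      · simp at az
      · exact h1 _ (hq z hz) k (by simp [q, c2, hNn])
      · simp at az
      · exact not_lt.1 c3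
    have dy := lt_of_le_of_lt (dist_le_pi_dist _ _ k) (huc _ ((hmem _).2 (hq y hy)) _ ((hmem _).2 (hq x hxx)) (hd y hy))
    have dz := lt_of_le_of_lt (dist_le_pi_dist _ _ k) (huc _ ((hmem _).2 (hq z hz)) _ ((hmem _).2 (hq x hxx)) (hd z hz))
    rw [Real.dist_eq, abs_lt] at dy dz
    rw [Real.norm_eq_abs, abs_lt]
    constructor <;> linarith
  exact absurd (hmin ((hmem _).2 (hq x hxx))) (not_le.2 hlt)

end LV

open Finset

namespace LV

theorem minimax {n : ℕ} {κ : Type} [Fintype κ]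
    (J : (Fin n → κ → ℝ) → ℝ) (G : (Fin n → κ → ℝ) → (Fin n → κ → ℝ))
    (hJ : Continuous J) (hG : Continuous G)
    (hder : ∀ u v : Fin n → κ → ℝ,
      HasDerivAt (fun t : ℝ => J (u + t • v)) (∑ i, ∑ k, G u i k * v i k) 0)
    (habs : ∀ u : Fin n → κ → ℝ, J (fun i k => |u i k|) ≤ J u)
    (hface : ∀ u : Fin n → κ → ℝ, ∀ i, (∀ k, u i k = 0) → ∀ k, G u i k = 0)
    (R1 : ℝ) (hco : ∀ u : Fin n → κ → ℝ, (∀ i k, 0 ≤ u i k) → R1 ≤ ‖u‖ → ∃ i k, 1 ≤ |G u i k|)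
    (τ : Fin n → ℝ) (hτ : ∀ i, 0 < τ i)
    (hS : ∀ u : Fin n → κ → ℝ, (∀ i k, 0 ≤ u i k) → (∀ i, ∑ k, u i k = τ i) → 0 < J u)
    (ub : Fin n → κ → ℝ) (hub : ∀ i k, 0 ≤ ub i k) (hubτ : ∀ i, τ i ≤ ∑ k, ub i k)
    (β : ℝ) (hβ : ∀ s : Fin n → ℝ, (∀ i, 0 ≤ s i ∧ s i ≤ 1) → J (fun i k => s i * ub i k) ≤ β)
    (htop : ∀ s : Fin n → ℝ, (∀ i, 0 ≤ s i ∧ s i ≤ 1) → ∀ i, s i = 1 →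
      J (fun i k => s i * ub i k) ≤ 0) :
    ∃ u : Fin n → κ → ℝ, (∀ i k, 0 ≤ u i k) ∧ G u = 0 ∧ 0 < J u ∧ J u ≤ β := by
  have hev : ∀ (i : Fin n) (k : κ), Continuous (fun u : Fin n → κ → ℝ => u i k) := by
    intro i k; fun_prop
  have hcone : IsClosed {u : Fin n → κ → ℝ | ∀ i k, 0 ≤ u i k} := by
    simp only [Set.ofPred_forall]
    exact isClosed_iInter fun i => isClosed_iInter fun k => isClosed_le continuous_const (hev i k)
  -- the level alpha
  obtain ⟨α, hα, hSα⟩ : ∃ α > 0, ∀ u : Fin n → κ → ℝ, (∀ i k, 0 ≤ u i k) →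
      (∀ i, ∑ k, u i k = τ i) → α ≤ J u := by
    set Sg : Set (Fin n → κ → ℝ) := {u | ∀ i k, 0 ≤ u i k} ∩ {u | ∀ i, ∑ k, u i k = τ i} with hSg
    have hcl : IsClosed Sg := by
      refine hcone.inter ?_
      simp only [Set.ofPred_forall]
      exact isClosed_iInter fun i => isClosed_eq (by fun_prop) continuous_const
    have hcp : IsCompact Sg := by
      refine (isCompact_Icc (a := (0 : Fin n → κ → ℝ)) (b := fun i _ => τ i)).of_isClosed_subset hcl ?_
      rintro u ⟨h1, h2⟩
      refine ⟨fun i k => h1 i k, fun i k => ?_⟩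
      show u i k ≤ τ i
      rw [← h2 i]
      exact single_le_sum (f := fun k => u i k) (fun k _ => h1 i k) (mem_univ k)
    rcases Sg.eq_empty_or_nonempty with he | hne
    · refine ⟨1, one_pos, fun u h1 h2 => ?_⟩
      have : u ∈ Sg := ⟨h1, h2⟩
      rw [he] at this
      exact this.elim
    · obtain ⟨u0, hu0, hmin⟩ := hcp.exists_isMinOn hne hJ.continuousOn
      exact ⟨J u0, hS u0 hu0.1 hu0.2, fun u h1 h2 => hmin ⟨h1, h2⟩⟩
  by_contra hcon
  push Not at hcon
  set S : (Fin n → κ → ℝ) → ℝ := fun u => Real.sqrt (∑ i, ∑ k, G u i k ^ 2) with hSdef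
  have hGe : ∀ (i : Fin n) (k : κ), Continuous (fun u => G u i k) := fun i k => (hev i k).comp hG
  have hScont : Continuous S := by
    refine Real.continuous_sqrt.comp ?_
    exact continuous_finsetSum _ fun i _ => continuous_finsetSum _ fun k _ => (hGe i k).pow 2
  have hSsq : ∀ u, S u ^ 2 = ∑ i, ∑ k, G u i k ^ 2 := fun u =>
    Real.sq_sqrt (sum_nonneg fun i _ => sum_nonneg fun k _ => sq_nonneg _)
  have hGS : ∀ u i k, |G u i k| ≤ S u := by
    intro u i k
    refine Real.abs_le_sqrt ?_
    refine le_trans ?_ (single_le_sum (f := fun i => ∑ k, G u i k ^ 2)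
      (fun i _ => sum_nonneg fun k _ => sq_nonneg _) (mem_univ i))
    exact single_le_sum (f := fun k => G u i k ^ 2) (fun k _ => sq_nonneg _) (mem_univ k)
  obtain ⟨δ, hδ, hδS⟩ : ∃ δ > 0, ∀ u : Fin n → κ → ℝ, (∀ i k, 0 ≤ u i k) → α / 4 ≤ J u → J u ≤ β →
      δ ≤ S u := by
    set C : Set (Fin n → κ → ℝ) := ({u | ∀ i k, 0 ≤ u i k} ∩ {u | α / 4 ≤ J u ∧ J u ≤ β}) ∩
      Metric.closedBall 0 R1 with hC
    have hcl : IsClosed ({u | ∀ i k, 0 ≤ u i k} ∩ {u | α / 4 ≤ J u ∧ J u ≤ β} :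
        Set (Fin n → κ → ℝ)) := by
      refine hcone.inter ?_
      rw [Set.ofPred_and]
      exact (isClosed_le continuous_const hJ).inter (isClosed_le hJ continuous_const)
    have hcp : IsCompact C := (isCompact_closedBall _ _).inter_left hcl
    have main : ∃ δ > 0, ∀ u ∈ C, δ ≤ S u := by
      rcases C.eq_empty_or_nonempty with he | hne
      · exact ⟨1, one_pos, fun u hu => by rw [he] at hu; exact hu.elim⟩
      · obtain ⟨u0, hu0, hmin⟩ := hcp.exists_isMinOn hne hScont.continuousOn
        refine ⟨S u0, ?_, fun u hu => hmin hu⟩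
        by_contra hle
        have h0 : S u0 = 0 := le_antisymm (not_lt.1 hle) (Real.sqrt_nonneg _)
        refine absurd hu0.1.2.2 (not_le.2 (hcon u0 hu0.1.1 ?_ (lt_of_lt_of_le (by positivity) hu0.1.2.1)))
        funext i k
        have := hGS u0 i k
        rw [h0] at this
        exact abs_nonpos_iff.1 this
    obtain ⟨δ, hδ, hm⟩ := main
    refine ⟨min δ 1, by positivity, fun u h1 h2 h3 => ?_⟩
    rcases le_total ‖u‖ R1 with h | h
    · exact (min_le_left _ _).trans (hm u ⟨⟨h1, h2, h3⟩, by simpa using h⟩)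
    · obtain ⟨i, k, hik⟩ := hco u h1 h
      exact (min_le_right _ _).trans (hik.trans (hGS u i k))
  set b := |β| + 1 with hb
  have hbpos : 0 < b := by positivity
  set R' := ‖ub‖ + 2 * b / δ + 2 with hR'
  set q : ℝ := (Fintype.card (Fin n) : ℝ) * Fintype.card κ + 1 with hq
  have hqpos : 0 < q := by positivity
  obtain ⟨h, hh0, hh1, huc⟩ : ∃ h > 0, h ≤ 1 ∧ ∀ x y : Fin n → κ → ℝ, ‖x‖ ≤ R' + 1 → ‖y‖ ≤ R' + 1 →
      dist x y ≤ h → dist (G x) (G y) ≤ δ / (2 * q) := by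
    have := (isCompact_closedBall (0 : Fin n → κ → ℝ) (R' + 1)).uniformContinuousOn_of_continuous
      hG.continuousOn
    rw [Metric.uniformContinuousOn_iff] at this
    obtain ⟨e, he, hh⟩ := this (δ / (2 * q)) (by positivity)
    refine ⟨min (e / 2) 1, by positivity, min_le_right _ _, fun x y hx hy hxy => ?_⟩
    refine (hh x (by simpa using hx) y (by simpa using hy) ?_).le
    have := hxy.trans (min_le_left _ _)
    linarith
  set χ : ℝ → ℝ := fun t => min 1 (max 0 (4 * t / α - 1)) with hχ
  have hχ0 : ∀ t, 0 ≤ χ t := fun t => le_min zero_le_one (le_max_left _ _)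
  have hχ1 : ∀ t, χ t ≤ 1 := fun t => min_le_left _ _
  have hχlow : ∀ t, t ≤ α / 4 → χ t = 0 := by
    intro t ht
    have : 4 * t / α - 1 ≤ 0 := by
      rw [sub_nonpos, div_le_one hα]; linarith
    simp [hχ, max_eq_left this]
  have hχhigh : ∀ t, α / 2 ≤ t → χ t = 1 := by
    intro t ht
    have : 1 ≤ 4 * t / α - 1 := by
      rw [le_sub_iff_add_le, le_div_iff₀ hα]; linarith
    simp only [hχ]
    exact min_eq_left (this.trans (le_max_right _ _))
  have hχc : Continuous χ := by simp only [hχ]; fun_prop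
  set v : (Fin n → κ → ℝ) → (Fin n → κ → ℝ) := fun u i k => -(χ (J u) * G u i k / max (S u) δ) with hv
  have hmaxpos : ∀ u, 0 < max (S u) δ := fun u => lt_max_of_lt_right hδ
  have hvabs : ∀ u i k, |v u i k| ≤ χ (J u) := by
    intro u i k
    simp only [hv]
    rw [abs_neg, abs_div, abs_of_pos (hmaxpos u), div_le_iff₀ (hmaxpos u), abs_mul,
      abs_of_nonneg (hχ0 _)]
    exact mul_le_mul_of_nonneg_left ((hGS u i k).trans (le_max_left _ _)) (hχ0 _)
  set T : (Fin n → κ → ℝ) → (Fin n → κ → ℝ) := fun u i k => |u i k + h * v u i k| with hT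
  have hTc : Continuous T := by
    refine continuous_pi fun i => continuous_pi fun k => ?_
    refine (((hev i k)).add (continuous_const.mul ?_)).abs
    exact (((hχc.comp hJ).mul (hGe i k)).div (hScont.max continuous_const)
      fun u => (hmaxpos u).ne').neg
  have hTpos : ∀ u i k, 0 ≤ T u i k := fun u i k => abs_nonneg _
  have hTstat : ∀ u : Fin n → κ → ℝ, (∀ i k, 0 ≤ u i k) → J u ≤ α / 4 → T u = u := by
    intro u hu hJu
    funext i k
    simp [hT, hv, hχlow _ hJu, abs_of_nonneg (hu i k)]
  have hTface : ∀ u : Fin n → κ → ℝ, ∀ i, (∀ k, u i k = 0) → ∀ k, T u i k = 0 := by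
    intro u i h0 k
    simp [hT, hv, hface u i h0 k, h0 k]
  have hTnorm : ∀ u : Fin n → κ → ℝ, (∀ i k, 0 ≤ u i k) → ‖T u‖ ≤ ‖u‖ + h := by
    intro u hu
    refine (pi_norm_le_iff_of_nonneg (by positivity)).2 fun i =>
      (pi_norm_le_iff_of_nonneg (by positivity)).2 fun k => ?_
    simp only [hT, Real.norm_eq_abs, abs_abs]
    refine (abs_add_le _ _).trans (add_le_add ?_ ?_)
    · exact (norm_le_pi_norm (u i) k).trans (norm_le_pi_norm u i)
    · rw [abs_mul, abs_of_pos hh0]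
      have := (hvabs u i k).trans (hχ1 _)
      nlinarith
  have hdesc : ∀ u : Fin n → κ → ℝ, (∀ i k, 0 ≤ u i k) → ‖u‖ ≤ R' → J u ≤ β →
      J (T u) ≤ J u - h * δ / 2 * χ (J u) := by
    intro u hu huR huβ
    rcases le_total (J u) (α / 4) with hlow | hhigh
    · rw [hTstat u hu hlow, hχlow _ hlow]; simp
    have hSu := hδS u hu hhigh huβ
    refine (habs (u + h • v u)).trans ?_
    have hd : ∀ t : ℝ, HasDerivAt (fun t : ℝ => J (u + t • v u))
        (∑ i, ∑ k, G (u + t • v u) i k * v u i k) t := by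
      intro t
      have h1 := hder (u + t • v u) (v u)
      have h2 : HasDerivAt (fun x : ℝ => x - t) 1 t := (hasDerivAt_id t).sub_const t
      have h3 := HasDerivAt.comp t (h₂ := fun x : ℝ => J (u + t • v u + x • v u))
        (by simpa using h1) h2
      rw [mul_one] at h3
      refine h3.congr_of_eventuallyEq (Filter.Eventually.of_forall fun x => ?_)
      simp only [Function.comp]
      congr 1
      rw [add_assoc, ← add_smul]; congr 2; ring
    obtain ⟨t, ht, hmv⟩ := exists_hasDerivAt_eq_slope (fun t : ℝ => J (u + t • v u)) _ hh0
      (fun x _ => (hd x).continuousAt.continuousWithinAt) (fun x _ => hd x)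
    simp only [zero_smul, add_zero, sub_zero] at hmv
    rw [eq_div_iff hh0.ne'] at hmv
    have hvn : ‖v u‖ ≤ 1 := (pi_norm_le_iff_of_nonneg zero_le_one).2 fun i =>
      (pi_norm_le_iff_of_nonneg zero_le_one).2 fun k => by
        rw [Real.norm_eq_abs]; exact (hvabs u i k).trans (hχ1 _)
    have htv : ‖t • v u‖ ≤ h := by
      rw [norm_smul, Real.norm_eq_abs, abs_of_pos ht.1]
      nlinarith [ht.2, ht.1]
    have hGd : dist (G (u + t • v u)) (G u) ≤ δ / (2 * q) := by
      apply huc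
      · refine (norm_add_le _ _).trans ?_; linarith
      · linarith
      · rw [dist_eq_norm]; simpa using htv
    have hbound : ∑ i, ∑ k, G (u + t • v u) i k * v u i k ≤ -(δ / 2 * χ (J u)) := by
      have e1 : ∑ i, ∑ k, G (u + t • v u) i k * v u i k
          = ∑ i, ∑ k, G u i k * v u i k + ∑ i, ∑ k, (G (u + t • v u) i k - G u i k) * v u i k := by
        simp only [← sum_add_distrib]
        refine sum_congr rfl fun i _ => sum_congr rfl fun k _ => by ring
      have e2 : ∑ i, ∑ k, G u i k * v u i k = -(χ (J u) * S u) := by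
        have : ∑ i, ∑ k, G u i k * v u i k = -(χ (J u) / max (S u) δ) * ∑ i, ∑ k, G u i k ^ 2 := by
          simp only [mul_sum, hv]
          refine sum_congr rfl fun i _ => sum_congr rfl fun k _ => by ring
        rw [this, ← hSsq, max_eq_left hSu]
        have : S u ≠ 0 := (hδ.trans_le hSu).ne'
        field_simp
      have e3 : ∑ i, ∑ k, (G (u + t • v u) i k - G u i k) * v u i k
          ≤ ∑ i : Fin n, ∑ k : κ, δ / (2 * q) * χ (J u) := by
        refine sum_le_sum fun i _ => sum_le_sum fun k _ => ?_
        refine (le_abs_self _).trans ?_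
        rw [abs_mul]
        refine mul_le_mul ?_ (hvabs u i k) (abs_nonneg _) (by positivity)
        rw [← Real.dist_eq]
        exact (dist_le_pi_dist _ _ k).trans ((dist_le_pi_dist _ _ i).trans hGd)
      have e4 : ∑ i : Fin n, ∑ k : κ, δ / (2 * q) * χ (J u) ≤ δ / 2 * χ (J u) := by
        simp only [sum_const, card_univ, nsmul_eq_mul]
        have : (Fintype.card (Fin n) : ℝ) * (Fintype.card κ * (δ / (2 * q) * χ (J u)))
          = (δ / 2 * χ (J u)) * ((q - 1) / q) := by
            rw [hq]; field_simp; ring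
        rw [this]
        have h5 : (q - 1) / q ≤ 1 := by rw [div_le_one hqpos]; linarith
        have h6 : 0 ≤ δ / 2 * χ (J u) := mul_nonneg (by positivity) (hχ0 _)
        nlinarith
      have e5 : χ (J u) * δ ≤ χ (J u) * S u := mul_le_mul_of_nonneg_left hSu (hχ0 _)
      rw [e1, e2]
      linarith
    have := mul_le_mul_of_nonneg_right hbound hh0.le
    linarith
  obtain ⟨M, hM1, hM2⟩ : ∃ M : ℕ, 2 * b / δ ≤ M * h ∧ M * h ≤ 2 * b / δ + 1 := by
    refine ⟨⌈2 * b / δ / h⌉₊, ?_, ?_⟩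
    · rw [← div_le_iff₀ hh0]; exact Nat.le_ceil _
    · have := (Nat.ceil_lt_add_one (a := 2 * b / δ / h) (by positivity)).le
      have h2 := mul_le_mul_of_nonneg_right this hh0.le
      rw [add_mul, div_mul_cancel₀ _ hh0.ne'] at h2
      linarith
  -- the iteration
  have hiter : ∀ u : Fin n → κ → ℝ, (∀ i k, 0 ≤ u i k) → ‖u‖ ≤ ‖ub‖ → J u ≤ β → ∀ m : ℕ, m ≤ M →
      (∀ i k, 0 ≤ (T^[m] u) i k) ∧ ‖T^[m] u‖ ≤ ‖ub‖ + m * h ∧ J (T^[m] u) ≤ β ∧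
      J (T^[m] u) ≤ max (α / 2) (β - m * h * δ / 2) := by
    intro u hu hun huβ m
    induction m with
    | zero => intro _; simpa using ⟨hu, hun, huβ, Or.inr huβ⟩
    | succ m ih =>
      intro hm
      obtain ⟨i1, i2, i3, i4⟩ := ih (by omega)
      rw [Function.iterate_succ_apply']
      set y := T^[m] u
      have hmM : (m : ℝ) * h ≤ M * h := by
        have : (m : ℝ) ≤ M := by exact_mod_cast (by omega : m ≤ M)
        nlinarith
      have hd := hdesc y i1 (by rw [hR']; linarith) i3
      have hle : J (T y) ≤ J y := by
        have : 0 ≤ h * δ / 2 * χ (J y) := mul_nonneg (by positivity) (hχ0 _)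
        linarith
      refine ⟨hTpos y, ?_, hle.trans i3, ?_⟩
      · refine (hTnorm y i1).trans ?_
        push_cast
        linarith
      · rcases le_total (J y) (α / 2) with h1 | h1
        · exact le_max_of_le_left (hle.trans h1)
        · rw [hχhigh _ h1] at hd
          rcases le_total (α / 2) (β - m * h * δ / 2) with h2 | h2
          · rw [max_eq_right h2] at i4
            apply le_max_of_le_right
            push_cast
            linarith
          · rw [max_eq_left h2] at i4
            exact le_max_of_le_left (hle.trans i4)
  have hstat : ∀ u : Fin n → κ → ℝ, (∀ i k, 0 ≤ u i k) → J u ≤ α / 4 → ∀ m : ℕ, T^[m] u = u := by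
    intro u hu hJu m
    exact Function.iterate_fixed (hTstat u hu hJu) m
  have hfaceit : ∀ u : Fin n → κ → ℝ, ∀ i, (∀ k, u i k = 0) → ∀ m : ℕ, ∀ k, (T^[m] u) i k = 0 := by
    intro u i h0 m
    induction m with
    | zero => simpa using h0
    | succ m ih => rw [Function.iterate_succ_apply']; exact hTface _ i ih
  set γ : (Fin n → ℝ) → (Fin n → κ → ℝ) := fun s i k => s i * ub i k with hγ
  have hγc : Continuous γ := by simp only [hγ]; fun_prop
  have hγpos : ∀ s : Fin n → ℝ, (∀ i, 0 ≤ s i ∧ s i ≤ 1) → ∀ i k, 0 ≤ γ s i k :=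
    fun s hs i k => mul_nonneg (hs i).1 (hub i k)
  have hγn : ∀ s : Fin n → ℝ, (∀ i, 0 ≤ s i ∧ s i ≤ 1) → ‖γ s‖ ≤ ‖ub‖ := by
    intro s hs
    refine (pi_norm_le_iff_of_nonneg (by positivity)).2 fun i =>
      (pi_norm_le_iff_of_nonneg (by positivity)).2 fun k => ?_
    have h1 : ‖ub i k‖ ≤ ‖ub‖ := (norm_le_pi_norm (ub i) k).trans (norm_le_pi_norm ub i)
    refine le_trans ?_ h1
    simp only [hγ, norm_mul, Real.norm_eq_abs, abs_of_nonneg (hs i).1]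
    have := (hs i).2
    nlinarith [abs_nonneg (ub i k)]
  obtain ⟨s, hs, hgs⟩ := poincare_miranda n (fun s i => ∑ k, (T^[M] (γ s)) i k - τ i)
    (by
      refine continuous_pi fun i => Continuous.sub ?_ continuous_const
      exact continuous_finsetSum _ fun k _ => (hev i k).comp ((hTc.iterate M).comp hγc))
    (by
      intro s hs i hi
      have : ∀ k, (T^[M] (γ s)) i k = 0 := hfaceit _ i (by intro k; simp [hγ, hi]) M
      simp [this, (hτ i).le])
    (by
      intro s hs i hi
      beta_reduce
      rw [hstat _ (hγpos s hs) ((htop s hs i hi).trans (by positivity))]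
      have := hubτ i
      simp only [hγ, hi, one_mul]
      linarith)
  obtain ⟨j1, -, -, j4⟩ := hiter (γ s) (hγpos s hs) (hγn s hs) (hβ s hs) M le_rfl
  have hSg2 := hSα _ j1 (fun i => by
    have := congrFun hgs i
    simp only [Pi.zero_apply] at this
    linarith)
  have : max (α / 2) (β - M * h * δ / 2) < α := by
    refine max_lt (by linarith) ?_
    have h1 : 2 * b ≤ M * h * δ := by rwa [div_le_iff₀ hδ] at hM1
    have h2 := le_abs_self β
    linarith
  linarith

end LV

open Finset

namespace LV

noncomputable def psi (q x : ℝ) : ℝ := (max x 0) ^ (q - 1) - (max (-x) 0) ^ (q - 1)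

noncomputable def ff {n : ℕ} (q : ℝ) (B : Matrix (Fin n) (Fin n) ℝ) (d : Fin n → ℝ) (i : Fin n) : ℝ :=
  (∑ j, B i j * |d j| ^ q) * psi q (d i)

lemma psi_of_nonneg {q x : ℝ} (hq : 1 < q) (hx : 0 ≤ x) : psi q x = x ^ (q - 1) := by
  unfold psi
  rw [max_eq_left hx, max_eq_right (by linarith : -x ≤ 0), Real.zero_rpow (by linarith), sub_zero]

lemma psi_neg (q x : ℝ) : psi q (-x) = - psi q x := by
  unfold psi; rw [neg_neg]; ring

lemma psi_zero (q : ℝ) : psi q 0 = 0 := by simp [psi]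

lemma psi_cont {q : ℝ} (hq : 1 < q) : Continuous (psi q) := by
  unfold psi
  refine Continuous.sub ?_ ?_
  · exact (Real.continuous_rpow_const (by linarith)).comp (by fun_prop)
  · exact (Real.continuous_rpow_const (by linarith)).comp (by fun_prop)

lemma abs_rpow_cont {q : ℝ} (hq : 1 < q) : Continuous (fun x : ℝ => |x| ^ q) :=
  (Real.continuous_rpow_const (by linarith)).comp continuous_abs

lemma psi_eq {q : ℝ} (hq : 1 < q) (x : ℝ) : |x| ^ (q - 2) * x = psi q x := by
  have key : ∀ x : ℝ, 0 ≤ x → |x| ^ (q - 2) * x = psi q x := by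
    intro x hx
    rw [psi_of_nonneg hq hx, abs_of_nonneg hx]
    rcases hx.eq_or_lt with h | h
    · rw [← h, Real.zero_rpow (by linarith : q - 1 ≠ 0), mul_zero]
    · rw [← Real.rpow_add_one h.ne']; congr 1; ring
  rcases le_total 0 x with h | h
  · exact key x h
  · have := key (-x) (by linarith)
    rw [psi_neg, abs_neg] at this
    linarith

lemma hasDeriv_abs_rpow {q : ℝ} (hq : 1 < q) (x : ℝ) :
    HasDerivAt (fun x : ℝ => |x| ^ q) (q * psi q x) x := by
  have := hasDerivAt_abs_rpow x hq
  rw [← psi_eq hq, ← mul_assoc]; exact this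

lemma mul_psi {q : ℝ} (hq : 1 < q) (x : ℝ) : psi q x * x = |x| ^ q := by
  have key : ∀ x : ℝ, 0 ≤ x → psi q x * x = |x| ^ q := by
    intro x hx
    rw [psi_of_nonneg hq hx, abs_of_nonneg hx]
    rcases hx.eq_or_lt with h | h
    · rw [← h, Real.zero_rpow (by linarith : q ≠ 0), mul_zero]
    · rw [← Real.rpow_add_one h.ne']; congr 1; ring
  rcases le_total 0 x with h | h
  · exact key x h
  · have := key (-x) (by linarith)
    rw [psi_neg, abs_neg] at this
    linarith

lemma ff_cont {n : ℕ} {q : ℝ} (hq : 1 < q) (B : Matrix (Fin n) (Fin n) ℝ) : Continuous (ff q B) := by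
  refine continuous_pi fun i => Continuous.mul ?_ ((psi_cont hq).comp (continuous_apply i))
  exact continuous_finsetSum _ fun j _ => continuous_const.mul ((abs_rpow_cont hq).comp (continuous_apply j))

lemma ff_zero {n : ℕ} {q : ℝ} (B : Matrix (Fin n) (Fin n) ℝ) (d : Fin n → ℝ) (i : Fin n)
    (h : d i = 0) : ff q B d i = 0 := by
  unfold ff; rw [h, psi_zero, mul_zero]

lemma ff_smul {n : ℕ} {q : ℝ} (hq : 1 < q) (B : Matrix (Fin n) (Fin n) ℝ) (d : Fin n → ℝ)
    (hd : ∀ i, 0 ≤ d i) (t : ℝ) (ht : 0 < t) (i : Fin n) :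
    ff q B (fun j => t * d j) i = t ^ (2 * q - 1) * ff q B d i := by
  unfold ff
  rw [psi_of_nonneg hq (mul_nonneg ht.le (hd i)), psi_of_nonneg hq (hd i),
    Real.mul_rpow ht.le (hd i)]
  have : ∀ j, B i j * |t * d j| ^ q = t ^ q * (B i j * |d j| ^ q) := by
    intro j
    rw [abs_mul, Real.mul_rpow (abs_nonneg _) (abs_nonneg _), abs_of_pos ht]; ring
  simp only [this, ← mul_sum]
  rw [show 2 * q - 1 = q + (q - 1) by ring, Real.rpow_add ht]
  ring

section lattice
variable {n K : ℕ} [NeZero K]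

noncomputable def QQ (u : Fin n → ZMod K → ℝ) : ℝ := ∑ i, ∑ k, (u i (k + 1) - u i k) ^ 2

noncomputable def WW (q : ℝ) (B : Matrix (Fin n) (Fin n) ℝ) (u : Fin n → ZMod K → ℝ) : ℝ :=
  ∑ k, ∑ i, ∑ j, B i j * |u i k| ^ q * |u j k| ^ q

noncomputable def JJ (q : ℝ) (B : Matrix (Fin n) (Fin n) ℝ) (u : Fin n → ZMod K → ℝ) : ℝ :=
  1 / 2 * QQ u - 1 / (2 * q) * WW q B u

noncomputable def GG (q : ℝ) (B : Matrix (Fin n) (Fin n) ℝ) (u : Fin n → ZMod K → ℝ) :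
    Fin n → ZMod K → ℝ :=
  fun i k => 2 * u i k - u i (k + 1) - u i (k - 1) - ff q B (fun j => u j k) i

lemma QQ_cont : Continuous (QQ : (Fin n → ZMod K → ℝ) → ℝ) := by
  unfold QQ; fun_prop

lemma WW_cont {q : ℝ} (hq : 1 < q) (B : Matrix (Fin n) (Fin n) ℝ) :
    Continuous (WW q B : (Fin n → ZMod K → ℝ) → ℝ) := by
  unfold WW
  refine continuous_finsetSum _ fun k _ => continuous_finsetSum _ fun i _ =>
    continuous_finsetSum _ fun j _ => ?_
  have h : ∀ i k, Continuous (fun u : Fin n → ZMod K → ℝ => |u i k| ^ q) := fun i k =>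
    (abs_rpow_cont hq).comp (by fun_prop : Continuous fun u : Fin n → ZMod K → ℝ => u i k)
  exact (continuous_const.mul (h i k)).mul (h j k)

lemma JJ_cont {q : ℝ} (hq : 1 < q) (B : Matrix (Fin n) (Fin n) ℝ) :
    Continuous (JJ q B : (Fin n → ZMod K → ℝ) → ℝ) :=
  (continuous_const.mul QQ_cont).sub (continuous_const.mul (WW_cont hq B))

lemma GG_cont {q : ℝ} (hq : 1 < q) (B : Matrix (Fin n) (Fin n) ℝ) :
    Continuous (GG q B : (Fin n → ZMod K → ℝ) → _) := by
  refine continuous_pi fun i => continuous_pi fun k => Continuous.sub (by fun_prop) ?_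
  exact (continuous_apply i).comp ((ff_cont hq B).comp (by fun_prop))

lemma sum_shift (g : ZMod K → ℝ) : ∑ k, g (k + 1) = ∑ k, g k :=
  Equiv.sum_comp (Equiv.addRight (1 : ZMod K)) g

lemma sum_parts (a b : ZMod K → ℝ) : ∑ k, (a (k + 1) - a k) * (b (k + 1) - b k)
    = ∑ k, (2 * a k - a (k + 1) - a (k - 1)) * b k := by
  have h1 := sum_shift (fun k => a k * b k)
  have h2 := sum_shift (fun k => a (k - 1) * b k)
  simp only [add_sub_cancel_right] at h2
  have : ∀ k, (a (k + 1) - a k) * (b (k + 1) - b k)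
    = a (k + 1) * b (k + 1) - a k * b (k + 1) - a (k + 1) * b k + a k * b k := fun k => by ring
  have h3 : ∀ k, (2 * a k - a (k + 1) - a (k - 1)) * b k
    = 2 * (a k * b k) - a (k + 1) * b k - a (k - 1) * b k := fun k => by ring
  simp only [this, h3, sum_add_distrib, sum_sub_distrib, ← mul_sum]
  rw [h1, h2]; ring

lemma sum_ff {q : ℝ} (hq : 1 < q) (B : Matrix (Fin n) (Fin n) ℝ) (u : Fin n → ZMod K → ℝ) :
    ∑ i, ∑ k, ff q B (fun j => u j k) i * u i k = WW q B u := by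
  unfold WW ff
  rw [sum_comm]
  refine sum_congr rfl fun k _ => sum_congr rfl fun i _ => ?_
  rw [mul_assoc, mul_psi hq, sum_mul]
  refine sum_congr rfl fun j _ => by ring

lemma sum_GG {q : ℝ} (hq : 1 < q) (B : Matrix (Fin n) (Fin n) ℝ) (u : Fin n → ZMod K → ℝ) :
    ∑ i, ∑ k, GG q B u i k * u i k = QQ u - WW q B u := by
  rw [← sum_ff hq]
  unfold GG QQ
  simp only [sub_mul _ (ff q B _ _), sum_sub_distrib]
  congr 1
  refine sum_congr rfl fun i _ => ?_
  rw [← sum_parts]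
  refine sum_congr rfl fun k _ => by ring

lemma JJ_deriv {q : ℝ} (hq : 1 < q) (B : Matrix (Fin n) (Fin n) ℝ) (hs : B.IsSymm)
    (u v : Fin n → ZMod K → ℝ) :
    HasDerivAt (fun t : ℝ => JJ q B (u + t • v)) (∑ i, ∑ k, GG q B u i k * v i k) 0 := by
  have hlin : ∀ i k, HasDerivAt (fun t : ℝ => (u + t • v) i k) (v i k) 0 := by
    intro i k
    simp only [Pi.add_apply, Pi.smul_apply, smul_eq_mul]
    simpa using ((hasDerivAt_id (0 : ℝ)).mul_const (v i k)).const_add (u i k)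
  have hz : ∀ i k, (u + (0 : ℝ) • v) i k = u i k := by intro i k; simp
  have hw : ∀ i k, HasDerivAt (fun t : ℝ => |(u + t • v) i k| ^ q) (q * psi q (u i k) * v i k) 0 := by
    intro i k
    have := HasDerivAt.comp (0 : ℝ) (h₂ := fun x : ℝ => |x| ^ q)
      (by rw [hz]; exact hasDeriv_abs_rpow hq (u i k)) (hlin i k)
    exact this
  have hQ : HasDerivAt (fun t : ℝ => QQ (u + t • v))
      (∑ i, ∑ k, 2 * ((u i (k + 1) - u i k) * (v i (k + 1) - v i k))) 0 := by
    unfold QQ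
    refine HasDerivAt.fun_sum fun i _ => HasDerivAt.fun_sum fun k _ => ?_
    have := ((hlin i (k + 1)).sub (hlin i k)).pow 2
    refine this.congr_deriv ?_
    simp; ring
  have hW : HasDerivAt (fun t : ℝ => WW q B (u + t • v))
      (∑ k, ∑ i, ∑ j, (B i j * (q * psi q (u i k) * v i k) * |u j k| ^ q
        + B i j * |u i k| ^ q * (q * psi q (u j k) * v j k))) 0 := by
    unfold WW
    refine HasDerivAt.fun_sum fun k _ => HasDerivAt.fun_sum fun i _ => HasDerivAt.fun_sum fun j _ => ?_
    have := ((hw i k).const_mul (B i j)).mul (hw j k)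
    refine this.congr_deriv ?_
    simp
  have := (hQ.const_mul (1 / 2)).sub (hW.const_mul (1 / (2 * q)))
  refine this.congr_deriv ?_
  have e1 : ∑ i, ∑ k, 2 * ((u i (k + 1) - u i k) * (v i (k + 1) - v i k))
     = 2 * ∑ i, ∑ k, (2 * u i k - u i (k + 1) - u i (k - 1)) * v i k := by
    rw [mul_sum]
    refine sum_congr rfl fun i _ => ?_
    rw [← mul_sum, sum_parts]
  have e2 : ∀ k, ∑ i, ∑ j, (B i j * (q * psi q (u i k) * v i k) * |u j k| ^ q
        + B i j * |u i k| ^ q * (q * psi q (u j k) * v j k))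
      = 2 * q * ∑ i, ff q B (fun j => u j k) i * v i k := by
    intro k
    have a1 : ∑ i, ∑ j, B i j * (q * psi q (u i k) * v i k) * |u j k| ^ q
        = q * ∑ i, ff q B (fun j => u j k) i * v i k := by
      unfold ff
      simp only [mul_sum, sum_mul]
      refine sum_congr rfl fun i _ => sum_congr rfl fun j _ => by ring
    have a2 : ∑ i, ∑ j, B i j * |u i k| ^ q * (q * psi q (u j k) * v j k)
        = q * ∑ i, ff q B (fun j => u j k) i * v i k := by
      rw [← a1, sum_comm]
      refine sum_congr rfl fun i _ => sum_congr rfl fun j _ => ?_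
      rw [hs.apply i j]; ring
    simp only [sum_add_distrib]
    rw [a1, a2]; ring
  rw [e1]
  simp only [e2]
  rw [← mul_sum, sum_comm (s := (univ : Finset (ZMod K)))]
  unfold GG
  simp only [sub_mul _ (ff q B _ _), sum_sub_distrib]
  have : q ≠ 0 := by linarith
  field_simp

lemma JJ_abs {q : ℝ} (hq : 1 < q) (B : Matrix (Fin n) (Fin n) ℝ) (u : Fin n → ZMod K → ℝ) :
    JJ q B (fun i k => |u i k|) ≤ JJ q B u := by
  unfold JJ
  have h1 : WW q B (fun i k => |u i k|) = WW q B u := by simp [WW]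
  have h2 : QQ (fun i k => |u i k|) ≤ QQ u := by
    refine sum_le_sum fun i _ => sum_le_sum fun k _ => ?_
    exact sq_le_sq.2 (abs_abs_sub_abs_le_abs_sub _ _)
  rw [h1]; linarith

lemma GG_face {q : ℝ} (B : Matrix (Fin n) (Fin n) ℝ) (u : Fin n → ZMod K → ℝ) (i : Fin n)
    (h : ∀ k, u i k = 0) (k : ZMod K) : GG q B u i k = 0 := by
  unfold GG
  rw [ff_zero B _ i (h k)]
  simp [h]

end lattice
end LV

open Finset

namespace LV

lemma exists_max {n K : ℕ} [NeZero K] (u : Fin n → ZMod K → ℝ) (hu : ∀ i k, 0 ≤ u i k)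
    (h0 : u ≠ 0) : ∃ i k, 0 < u i k ∧ u i k = ‖u‖ ∧ ∀ j l, u j l ≤ u i k := by
  have hne : Nonempty (Fin n) := by
    by_contra h
    rw [not_nonempty_iff] at h
    exact h0 (Subsingleton.elim _ _)
  obtain ⟨⟨i, k⟩, -, hmax⟩ := exists_max_image (univ : Finset (Fin n × ZMod K)) (fun x => u x.1 x.2)
    univ_nonempty
  have hm : ∀ j l, u j l ≤ u i k := fun j l => hmax (j, l) (mem_univ _)
  have he : u i k = ‖u‖ := by
    apply le_antisymm
    · have : ‖u i k‖ ≤ ‖u‖ := (norm_le_pi_norm (u i) k).trans (norm_le_pi_norm u i)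
      rwa [Real.norm_eq_abs, abs_of_nonneg (hu i k)] at this
    · refine (pi_norm_le_iff_of_nonneg (hu i k)).2 fun j =>
        (pi_norm_le_iff_of_nonneg (hu i k)).2 fun l => ?_
      rw [Real.norm_eq_abs, abs_of_nonneg (hu j l)]; exact hm j l
  exact ⟨i, k, by rw [he]; exact norm_pos_iff.2 h0, he, hm⟩

lemma coercive {n : ℕ} {q : ℝ} (hq : 1 < q) (B : Matrix (Fin n) (Fin n) ℝ) (κ : ℝ) (hκ : 0 < κ)
    (hB : ∀ d : Fin n → ℝ, (∀ i, 0 ≤ d i ∧ d i ≤ 1) → (∃ i, d i = 1) → ∃ i, κ ≤ |ff q B d i|)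
    {K : ℕ} [NeZero K] : ∃ R1 : ℝ, ∀ u : Fin n → ZMod K → ℝ, (∀ i k, 0 ≤ u i k) → R1 ≤ ‖u‖ →
      ∃ i k, 1 ≤ |GG q B u i k| := by
  refine ⟨max 1 ((3 / κ) ^ (1 / (2 * q - 2))), fun u hu hR => ?_⟩
  have hX1 : 1 ≤ ‖u‖ := (le_max_left _ _).trans hR
  have hX2 := (le_max_right _ _).trans hR
  obtain ⟨i0, k0, hpos, he, hm⟩ := exists_max u hu (by rintro rfl; simp at hX1; linarith)
  rw [← he] at hX1 hX2
  set X := u i0 k0 with hX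
  have h3 : 3 / κ ≤ X ^ (2 * q - 2) := by
    have := Real.rpow_le_rpow (by positivity) hX2 (by linarith : 0 ≤ 2 * q - 2)
    rwa [← Real.rpow_mul (by positivity), one_div_mul_cancel (by linarith), Real.rpow_one] at this
  obtain ⟨i, hi⟩ := hB (fun j => u j k0 / X)
    (fun j => ⟨div_nonneg (hu _ _) hpos.le, (div_le_one hpos).2 (hm _ _)⟩) ⟨i0, div_self hpos.ne'⟩
  refine ⟨i, k0, ?_⟩
  have h4 := ff_smul hq B (fun j => u j k0 / X) (fun j => div_nonneg (hu _ _) hpos.le) X hpos i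
  simp only [mul_div_cancel₀ _ hpos.ne'] at h4
  have h5 : 3 * X ≤ |ff q B (fun j => u j k0) i| := by
    rw [h4, abs_mul, abs_of_nonneg (by positivity)]
    have : X ^ (2 * q - 1) = X ^ (2 * q - 2) * X := by
      rw [← Real.rpow_add_one hpos.ne']; congr 1; ring
    rw [this]
    rw [div_le_iff₀ hκ] at h3
    calc 3 * X ≤ X ^ (2 * q - 2) * κ * X := by nlinarith
      _ = X ^ (2 * q - 2) * X * κ := by ring
      _ ≤ _ := mul_le_mul_of_nonneg_left hi (by positivity)
  have h6 : |2 * u i k0 - u i (k0 + 1) - u i (k0 - 1)| ≤ 2 * X := by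
    rw [abs_le]
    constructor <;> linarith [hu i k0, hu i (k0 + 1), hu i (k0 - 1), hm i k0, hm i (k0 + 1), hm i (k0 - 1)]
  have h7 := abs_sub_abs_le_abs_sub (ff q B (fun j => u j k0) i) (2 * u i k0 - u i (k0 + 1) - u i (k0 - 1))
  rw [abs_sub_comm (ff q B (fun j => u j k0) i)] at h7
  unfold GG
  linarith

lemma const_of_step {K : ℕ} [NeZero K] (a : ZMod K → ℝ) (h : ∀ k, a (k + 1) = a k) (k : ZMod K) :
    a k = a 0 := by
  have : ∀ m : ℕ, a (m : ZMod K) = a 0 := by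
    intro m
    induction m with
    | zero => simp
    | succ m ih => rw [Nat.cast_succ, h, ih]
  have h2 := this k.val
  rwa [ZMod.natCast_zmod_val] at h2

lemma QQ_nonneg {n K : ℕ} [NeZero K] (u : Fin n → ZMod K → ℝ) : 0 ≤ QQ u :=
  sum_nonneg fun _ _ => sum_nonneg fun _ _ => sq_nonneg _

lemma QQ_zero {n K : ℕ} [NeZero K] (u : Fin n → ZMod K → ℝ) (h : QQ u = 0) (i : Fin n) (k : ZMod K) :
    u i k = u i 0 := by
  refine const_of_step (u i) (fun k => ?_) k
  unfold QQ at h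
  rw [sum_eq_zero_iff_of_nonneg (fun _ _ => sum_nonneg fun _ _ => sq_nonneg _)] at h
  have h1 := h i (mem_univ i)
  rw [sum_eq_zero_iff_of_nonneg (fun _ _ => sq_nonneg _)] at h1
  have h2 := h1 k (mem_univ k)
  nlinarith

lemma QQ_smul {n K : ℕ} [NeZero K] (u : Fin n → ZMod K → ℝ) (r : ℝ) :
    QQ (fun i k => r * u i k) = r ^ 2 * QQ u := by
  unfold QQ
  simp only [mul_sum]
  refine sum_congr rfl fun i _ => sum_congr rfl fun k _ => by ring

lemma WW_smul {n K : ℕ} [NeZero K] (q : ℝ) (B : Matrix (Fin n) (Fin n) ℝ)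
    (u : Fin n → ZMod K → ℝ) (r : ℝ) (hr : 0 < r) :
    WW q B (fun i k => r * u i k) = r ^ (2 * q) * WW q B u := by
  unfold WW
  simp only [mul_sum]
  refine sum_congr rfl fun k _ => sum_congr rfl fun i _ => sum_congr rfl fun j _ => ?_
  rw [abs_mul, abs_mul, Real.mul_rpow (abs_nonneg _) (abs_nonneg _),
    Real.mul_rpow (abs_nonneg _) (abs_nonneg _), abs_of_pos hr, two_mul, Real.rpow_add hr]
  ring

lemma sphere {n : ℕ} {q : ℝ} (hq : 1 < q) (B : Matrix (Fin n) (Fin n) ℝ)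
    (e : Fin n → ℝ) (he : ∀ i, 0 < e i) (hneg : ∑ i, ∑ j, B i j * e i ^ q * e j ^ q < 0)
    {K : ℕ} [NeZero K] : ∃ r > 0, ∀ u : Fin n → ZMod K → ℝ, (∀ i k, 0 ≤ u i k) →
      (∀ i, ∑ k, u i k = r * (K * e i)) → 0 < JJ q B u := by
  set Sg : Set (Fin n → ZMod K → ℝ) := {u | ∀ i k, 0 ≤ u i k} ∩ {u | ∀ i, ∑ k, u i k = K * e i} with hSg
  have hcone : IsClosed {u : Fin n → ZMod K → ℝ | ∀ i k, 0 ≤ u i k} := by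
    simp only [Set.ofPred_forall]
    exact isClosed_iInter fun i => isClosed_iInter fun k => isClosed_le continuous_const (by fun_prop)
  have hcl : IsClosed Sg := by
    refine hcone.inter ?_
    simp only [Set.ofPred_forall]
    exact isClosed_iInter fun i => isClosed_eq (by fun_prop) continuous_const
  have hcp : IsCompact Sg := by
    refine (isCompact_Icc (a := (0 : Fin n → ZMod K → ℝ))
      (b := fun i _ => K * e i)).of_isClosed_subset hcl ?_
    rintro u ⟨h1, h2⟩
    refine ⟨fun i k => h1 i k, fun i k => ?_⟩
    show u i k ≤ K * e i
    rw [← h2 i]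
    exact single_le_sum (f := fun k => u i k) (fun k _ => h1 i k) (mem_univ k)
  obtain ⟨q0, hq0, hQ⟩ : ∃ q0 > 0, ∀ u ∈ Sg, 0 ≤ WW q B u → q0 ≤ QQ u := by
    have hcp2 : IsCompact (Sg ∩ {u | 0 ≤ WW q B u}) :=
      hcp.inter_right (isClosed_le continuous_const (WW_cont hq B))
    rcases (Sg ∩ {u | 0 ≤ WW q B u}).eq_empty_or_nonempty with hem | hne
    · refine ⟨1, one_pos, fun u h1 h2 => ?_⟩
      have : u ∈ Sg ∩ {u | 0 ≤ WW q B u} := ⟨h1, h2⟩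
      rw [hem] at this
      exact this.elim
    · obtain ⟨u0, hu0, hmin⟩ := hcp2.exists_isMinOn hne QQ_cont.continuousOn
      refine ⟨QQ u0, ?_, fun u h1 h2 => hmin ⟨h1, h2⟩⟩
      refine lt_of_le_of_ne (QQ_nonneg _) fun h => ?_
      have hc := QQ_zero u0 h.symm
      have hK : (K : ℝ) ≠ 0 := Nat.cast_ne_zero.2 (NeZero.ne K)
      have hval : ∀ i k, u0 i k = e i := by
        intro i k
        have h1 := hu0.1.2 i
        simp only [hc i, sum_const, card_univ, ZMod.card, nsmul_eq_mul] at h1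
        rw [hc i k]
        exact mul_left_cancel₀ hK h1
      have h2 : 0 ≤ WW q B u0 := hu0.2
      have h3 : WW q B u0 = K * ∑ i, ∑ j, B i j * e i ^ q * e j ^ q := by
        unfold WW
        simp only [hval, sum_const, card_univ, ZMod.card, nsmul_eq_mul, abs_of_pos (he _)]
      rw [h3] at h2
      have : (0 : ℝ) < K := Nat.cast_pos.2 (NeZero.pos K)
      nlinarith
  obtain ⟨W0, hW0⟩ := (hcp.image (WW_cont hq B)).bddAbove
  have hW : ∀ u ∈ Sg, WW q B u ≤ |W0| + 1 := fun u hu => by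
    have := hW0 ⟨u, hu, rfl⟩
    linarith [le_abs_self W0]
  set A := |W0| + 1 with hA
  have hApos : 0 < A := by positivity
  obtain ⟨r, hr, hr2⟩ : ∃ r > 0, r ^ (2 * q - 2) * A < q * q0 := by
    refine ⟨(q * q0 / (2 * A)) ^ (1 / (2 * q - 2)), by positivity, ?_⟩
    rw [← Real.rpow_mul (by positivity), one_div_mul_cancel (by linarith), Real.rpow_one]
    have : q * q0 / (2 * A) * A = q * q0 / 2 := by field_simp
    rw [this]
    have : 0 < q * q0 := by positivity
    linarith
  refine ⟨r, hr, fun u hu hs => ?_⟩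
  have huw : u = fun i k => r * (r⁻¹ * u i k) := by
    funext i k; field_simp
  set w : Fin n → ZMod K → ℝ := fun i k => r⁻¹ * u i k with hw
  have hwS : w ∈ Sg := by
    refine ⟨fun i k => mul_nonneg (by positivity) (hu i k), fun i => ?_⟩
    simp only [hw, ← mul_sum, hs i]
    field_simp
  rw [huw]
  unfold JJ
  rw [QQ_smul, WW_smul q B w r hr]
  have hrr : r ^ (2 * q) = r ^ 2 * r ^ (2 * q - 2) := by
    rw [← Real.rpow_natCast, ← Real.rpow_add hr]; congr 1; push_cast; ring
  have hrp : 0 < r ^ (2 * q - 2) := by positivity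
  have heq : 1 / 2 * (r ^ 2 * QQ w) - 1 / (2 * q) * (r ^ (2 * q) * WW q B w)
      = r ^ 2 / (2 * q) * (q * QQ w - r ^ (2 * q - 2) * WW q B w) := by
    rw [hrr]
    have : q ≠ 0 := by linarith
    field_simp
  rw [heq]
  refine mul_pos (by positivity) ?_
  rcases lt_or_ge (WW q B w) 0 with h | h
  · have h1 := QQ_nonneg w
    have h2 : 0 ≤ q * QQ w := by positivity
    have h3 : r ^ (2 * q - 2) * WW q B w < 0 := mul_neg_of_pos_of_neg hrp h
    linarith
  · have h1 := hQ w hwS h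
    have h2 := hW w hwS
    have h3 : r ^ (2 * q - 2) * WW q B w ≤ r ^ (2 * q - 2) * A := mul_le_mul_of_nonneg_left h2 hrp.le
    have h4 : q * q0 ≤ q * QQ w := mul_le_mul_of_nonneg_left h1 (by linarith)
    linarith

lemma gbd (a c p : ℝ) (ha : 0 < a) (hc : 0 < c) (hp : 2 < p) (t : ℝ) (ht : 0 ≤ t) :
    a * t ^ 2 - c * t ^ p ≤ a * (a / c) ^ (2 / (p - 2)) := by
  rcases ht.eq_or_lt with h | h
  · rw [← h, Real.zero_rpow (by linarith)]; simp; positivity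
  have e1 : t ^ p = t ^ 2 * t ^ (p - 2) := by
    rw [← Real.rpow_natCast, ← Real.rpow_add h]; congr 1; push_cast; ring
  have hexp : 0 < 2 / (p - 2) := div_pos two_pos (by linarith)
  rcases le_total (a / c) (t ^ (p - 2)) with h1 | h1
  · have : a ≤ c * t ^ (p - 2) := by rw [div_le_iff₀ hc] at h1; linarith
    have h2 : 0 ≤ a * (a / c) ^ (2 / (p - 2)) := by positivity
    rw [e1]
    nlinarith [sq_nonneg t]
  · have h2 := Real.rpow_le_rpow (by positivity) h1 hexp.le
    rw [← Real.rpow_mul ht, mul_div_cancel₀ _ (by linarith : p - 2 ≠ 0)] at h2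
    rw [show t ^ (2 : ℝ) = t ^ 2 by norm_cast] at h2
    have h3 : 0 ≤ c * t ^ p := by positivity
    have := mul_le_mul_of_nonneg_left h2 ha.le
    linarith

lemma glim (a c p M : ℝ) (ha : 0 < a) (hc : 0 < c) (hp : 2 < p) (hM : 0 ≤ M) :
    ∃ R0 : ℝ, ∀ R, R0 ≤ R → a * R ^ 2 - c * R ^ p ≤ -M := by
  refine ⟨max 1 (((a + M) / c) ^ (1 / (p - 2))), fun R hR => ?_⟩
  have h1 : 1 ≤ R := (le_max_left _ _).trans hR
  have h2 := (le_max_right _ _).trans hR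
  have hRp : 0 < R := by linarith
  have h3 := Real.rpow_le_rpow (by positivity) h2 (by linarith : 0 ≤ p - 2)
  rw [← Real.rpow_mul (by positivity), one_div_mul_cancel (by linarith), Real.rpow_one,
    div_le_iff₀ hc] at h3
  have e1 : R ^ p = R ^ 2 * R ^ (p - 2) := by
    rw [← Real.rpow_natCast, ← Real.rpow_add hRp]; congr 1; push_cast; ring
  rw [e1]
  have h4 : 1 ≤ R ^ 2 := by nlinarith
  nlinarith

lemma sum_zmod {K : ℕ} [NeZero K] (g : ℕ → ℝ) : ∑ k : ZMod K, g k.val = ∑ m ∈ range K, g m := by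
  refine sum_nbij ZMod.val (fun k _ => mem_range.2 (ZMod.val_lt k))
    (fun a _ b _ h => ZMod.val_injective K h) (fun m hm => ?_) (fun _ _ => rfl)
  have hm : m < K := by simpa using hm
  exact ⟨(m : ZMod K), by simp, ZMod.val_cast_of_lt hm⟩

/-- tents -/
noncomputable def tent (L i m : ℕ) : ℝ := max 0 (2 * L - |(m : ℝ) - (4 * i * L + 2 * L)|)

lemma tent_nonneg (L i m : ℕ) : 0 ≤ tent L i m := le_max_left _ _

lemma tent_disj (L i j m : ℕ) (h : i ≠ j) : tent L i m = 0 ∨ tent L j m = 0 := by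
  by_contra hc
  push Not at hc
  have key : ∀ i, tent L i m ≠ 0 → (4 * i * L : ℝ) < m ∧ (m : ℝ) < 4 * i * L + 4 * L := by
    intro i hi
    have : 0 < 2 * (L : ℝ) - |(m : ℝ) - (4 * i * L + 2 * L)| := by
      by_contra hcc
      exact hi (max_eq_left (not_lt.1 hcc))
    have h2 := abs_lt.1 (by linarith : |(m : ℝ) - (4 * i * L + 2 * L)| < 2 * L)
    constructor <;> linarith [h2.1, h2.2]
  obtain ⟨a1, a2⟩ := key i hc.1
  obtain ⟨b1, b2⟩ := key j hc.2
  have a1 : 4 * i * L < m := by exact_mod_cast a1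
  have a2 : m < 4 * i * L + 4 * L := by exact_mod_cast a2
  have b1 : 4 * j * L < m := by exact_mod_cast b1
  have b2 : m < 4 * j * L + 4 * L := by exact_mod_cast b2
  rcases lt_or_gt_of_ne h with h | h
  · have : (i + 1) * L ≤ j * L := Nat.mul_le_mul_right _ h
    nlinarith
  · have : (j + 1) * L ≤ i * L := Nat.mul_le_mul_right _ h
    nlinarith

lemma tent_lip (L i m : ℕ) : |tent L i (m + 1) - tent L i m| ≤ 1 := by
  unfold tent
  refine (abs_max_sub_max_le_max _ _ _ _).trans ?_
  refine max_le (by simp) ?_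
  rw [sub_sub_sub_cancel_left]
  refine (abs_abs_sub_abs_le_abs_sub _ _).trans ?_
  push_cast
  rw [abs_le]; constructor <;> linarith

lemma tent_wrap (L i n : ℕ) (hi : i < n) (hL : 0 < L) : |tent L i 0 - tent L i (4 * n * L - 1)| ≤ 1 := by
  have h0 : tent L i 0 = 0 := by
    unfold tent
    apply max_eq_left
    have : (0 : ℝ) ≤ 4 * i * L := by positivity
    have h3 : (0 : ℝ) ≤ L := by positivity
    rw [abs_of_nonpos (by push_cast; linarith)]
    push_cast; linarith
  have h1 : tent L i (4 * n * L - 1) ≤ 1 := by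
    unfold tent
    refine max_le zero_le_one ?_
    have : (i + 1) * L ≤ n * L := Nat.mul_le_mul_right _ hi
    have h2 : ((i + 1) * L : ℝ) ≤ n * L := by exact_mod_cast this
    have hpos : 1 ≤ 4 * n * L := by nlinarith
    rw [Nat.cast_sub hpos]
    push_cast
    have := le_abs_self ((4 * n * L - 1 : ℝ) - (4 * i * L + 2 * L))
    linarith
  rw [h0, zero_sub, abs_neg, abs_of_nonneg (tent_nonneg _ _ _)]
  exact h1

lemma tent_sum (L i n : ℕ) (hi : i < n) (p : ℝ) (hp : 0 < p) :
    L * (L : ℝ) ^ p ≤ ∑ m ∈ range (4 * n * L), tent L i m ^ p := by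
  have hsub : Ico (4 * i * L + 2 * L) (4 * i * L + 2 * L + L) ⊆ range (4 * n * L) := by
    intro m hm
    rw [mem_Ico] at hm
    rw [mem_range]
    have : (i + 1) * L ≤ n * L := Nat.mul_le_mul_right _ hi
    nlinarith
  refine le_trans ?_ (sum_le_sum_of_subset_of_nonneg hsub
    fun m _ _ => Real.rpow_nonneg (tent_nonneg _ _ _) _)
  have : ∑ m ∈ Ico (4 * i * L + 2 * L) (4 * i * L + 2 * L + L), (L : ℝ) ^ p = L * (L : ℝ) ^ p := by
    rw [sum_const, Nat.card_Ico, nsmul_eq_mul]; congr 2; omega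
  rw [← this]
  refine sum_le_sum fun m hm => ?_
  rw [mem_Ico] at hm
  refine Real.rpow_le_rpow (by positivity) ?_ hp.le
  unfold tent
  apply le_max_of_le_right
  have h1 : ((4 * i * L + 2 * L : ℕ) : ℝ) ≤ m := by exact_mod_cast hm.1
  have h2 : (m : ℝ) ≤ ((4 * i * L + 2 * L + L : ℕ) : ℝ) := by exact_mod_cast hm.2.le
  push_cast at h1 h2
  rw [abs_of_nonneg (by linarith)]
  linarith

end LV

open Finset

namespace LV

lemma JJ_tent {n : ℕ} {q : ℝ} (hq : 1 < q) (B : Matrix (Fin n) (Fin n) ℝ) (b : ℝ) (hb : 0 < b)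
    (hB : ∀ i, b ≤ B i i) (L : ℕ) (hL : 0 < L) [NeZero (4 * n * L)] (t : Fin n → ℝ) (ht : ∀ i, 0 ≤ t i) :
    JJ q B (fun i (k : ZMod (4 * n * L)) => t i * tent L i k.val) ≤
      ∑ i, (((4 * n * L : ℕ) : ℝ) / 2 * t i ^ 2 - (b * (L * (L : ℝ) ^ (2 * q)) / (2 * q)) * t i ^ (2 * q)) := by
  have hQ : QQ (fun i (k : ZMod (4 * n * L)) => t i * tent L i k.val) ≤
      ∑ i, ((4 * n * L : ℕ) : ℝ) * t i ^ 2 := by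
    refine sum_le_sum fun i _ => ?_
    have : ∀ k : ZMod (4 * n * L), (t i * tent L i (k + 1).val - t i * tent L i k.val) ^ 2 ≤ t i ^ 2 := by
      intro k
      have h1 : |tent L i (k + 1).val - tent L i k.val| ≤ 1 := by
        by_cases hk : k.val + 1 < 4 * n * L
        · have : (k + 1).val = k.val + 1 := by
            have h2 := ZMod.val_cast_of_lt hk
            rwa [Nat.cast_succ, ZMod.natCast_zmod_val] at h2
          rw [this]; exact tent_lip _ _ _
        · have h3 := ZMod.val_lt k
          have h4 : k.val = 4 * n * L - 1 := by omega
          have h5 : (k + 1).val = 0 := by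
            have h6 : k.val + 1 = 4 * n * L := by omega
            have h7 : ((k.val + 1 : ℕ) : ZMod (4 * n * L)) = 0 := by rw [h6, ZMod.natCast_self]
            rw [Nat.cast_succ, ZMod.natCast_zmod_val] at h7
            rw [h7, ZMod.val_zero]
          rw [h4, h5]; exact tent_wrap L i n i.2 hL
      rw [← mul_sub, mul_pow]
      have := (sq_le_one_iff_abs_le_one _).2 h1
      nlinarith [sq_nonneg (t i)]
    refine (sum_le_sum fun k _ => this k).trans ?_
    simp
  have hW : ∑ i, b * (L * (L : ℝ) ^ (2 * q)) * t i ^ (2 * q) ≤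
      WW q B (fun i (k : ZMod (4 * n * L)) => t i * tent L i k.val) := by
    have e1 : WW q B (fun i (k : ZMod (4 * n * L)) => t i * tent L i k.val)
        = ∑ i, B i i * t i ^ (2 * q) * ∑ m ∈ range (4 * n * L), tent L i m ^ (2 * q) := by
      unfold WW
      rw [sum_comm]
      refine sum_congr rfl fun i _ => ?_
      rw [← sum_zmod, mul_sum]
      refine sum_congr rfl fun k _ => ?_
      rw [sum_eq_single i]
      · rw [abs_of_nonneg (mul_nonneg (ht i) (tent_nonneg _ _ _)),
          Real.mul_rpow (ht i) (tent_nonneg _ _ _)]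
        have hx : ∀ x : ℝ, 0 ≤ x → x ^ (2 * q) = x ^ q * x ^ q := by
          intro x hx
          rw [two_mul, Real.rpow_add_of_nonneg hx (by linarith) (by linarith)]
        rw [hx _ (ht i), hx _ (tent_nonneg _ _ _)]
        ring
      · intro j _ hj
        have hq0 : q ≠ 0 := by linarith
        rcases tent_disj L i j k.val (fun h => hj (Fin.ext h.symm)) with h | h
        · simp [h, Real.zero_rpow hq0]
        · simp [h, Real.zero_rpow hq0]
      · intro h; exact absurd (mem_univ i) h
    rw [e1]
    refine sum_le_sum fun i _ => ?_
    have h1 := tent_sum L i n i.2 (2 * q) (by linarith)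
    have h2 : 0 ≤ t i ^ (2 * q) := Real.rpow_nonneg (ht i) _
    have h3 : (0 : ℝ) ≤ L * (L : ℝ) ^ (2 * q) := by positivity
    calc b * (L * (L : ℝ) ^ (2 * q)) * t i ^ (2 * q)
        = (b * t i ^ (2 * q)) * (L * (L : ℝ) ^ (2 * q)) := by ring
      _ ≤ (B i i * t i ^ (2 * q)) * (∑ m ∈ range (4 * n * L), tent L i m ^ (2 * q)) :=
        mul_le_mul (mul_le_mul_of_nonneg_right (hB i) h2) h1 h3
          (mul_nonneg (hb.le.trans (hB i)) h2)
  unfold JJ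
  have h4 : 1 / (2 * q) * ∑ i, b * (L * (L : ℝ) ^ (2 * q)) * t i ^ (2 * q) ≤
      1 / (2 * q) * WW q B (fun i (k : ZMod (4 * n * L)) => t i * tent L i k.val) :=
    mul_le_mul_of_nonneg_left hW (by positivity)
  have h5 : ∑ i, (((4 * n * L : ℕ) : ℝ) / 2 * t i ^ 2 - (b * (L * (L : ℝ) ^ (2 * q)) / (2 * q)) * t i ^ (2 * q))
     = 1 / 2 * (∑ i, ((4 * n * L : ℕ) : ℝ) * t i ^ 2)
      - 1 / (2 * q) * ∑ i, b * (L * (L : ℝ) ^ (2 * q)) * t i ^ (2 * q) := by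
    rw [sum_sub_distrib, mul_sum, mul_sum]
    congr 1
    · refine sum_congr rfl fun i _ => by ring
    · refine sum_congr rfl fun i _ => by ring
  rw [h5]
  linarith

lemma lattice_sol {n : ℕ} (hn : 0 < n) {q : ℝ} (hq : 1 < q) (B : Matrix (Fin n) (Fin n) ℝ) (hs : B.IsSymm)
    (b : ℝ) (hb : 0 < b) (hB : ∀ i, b ≤ B i i)
    (κ : ℝ) (hκ : 0 < κ)
    (hBκ : ∀ d : Fin n → ℝ, (∀ i, 0 ≤ d i ∧ d i ≤ 1) → (∃ i, d i = 1) → ∃ i, κ ≤ |ff q B d i|)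
    (e : Fin n → ℝ) (he : ∀ i, 0 < e i) (hneg : ∑ i, ∑ j, B i j * e i ^ q * e j ^ q < 0)
    (L : ℕ) (hL : 0 < L) [NeZero (4 * n * L)] :
    ∃ u : Fin n → ZMod (4 * n * L) → ℝ, (∀ i k, 0 ≤ u i k) ∧ GG q B u = 0 ∧ 0 < JJ q B u ∧
      JJ q B u ≤ n * (((4 * n * L : ℕ) : ℝ) / 2 *
        ((((4 * n * L : ℕ) : ℝ) / 2) / (b * (L * (L : ℝ) ^ (2 * q)) / (2 * q))) ^ (2 / (2 * q - 2))) := by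
  set K := 4 * n * L with hK
  have hKpos : 0 < K := by positivity
  have hKr : (0 : ℝ) < K := by exact_mod_cast hKpos
  set a := (K : ℝ) / 2 with ha
  set c := b * (L * (L : ℝ) ^ (2 * q)) / (2 * q) with hc
  have ha0 : 0 < a := by positivity
  have hL0 : (0 : ℝ) < L := by exact_mod_cast hL
  have hc0 : 0 < c := by positivity
  set M := a * (a / c) ^ (2 / (2 * q - 2)) with hM
  have hM0 : 0 ≤ M := by positivity
  have hbd := gbd a c (2 * q) ha0 hc0 (by linarith)
  obtain ⟨R0, hR0⟩ := glim a c (2 * q) (n * M) ha0 hc0 (by linarith) (by positivity)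
  obtain ⟨R1, hR1⟩ := coercive hq B κ hκ hBκ (K := K)
  obtain ⟨r, hr, hr2⟩ := sphere hq B e he hneg (K := K)
  set R := max (max R0 1) (∑ i, r * (K * e i)) with hR
  have hRR0 : R0 ≤ R := (le_max_left _ _).trans (le_max_left _ _)
  have hR1' : 1 ≤ R := (le_max_right _ _).trans (le_max_left _ _)
  have hJ : ∀ s : Fin n → ℝ, (∀ i, 0 ≤ s i ∧ s i ≤ 1) →
      JJ q B (fun i (k : ZMod K) => s i * (R * tent L i k.val)) ≤
      ∑ i, (a * (s i * R) ^ 2 - c * (s i * R) ^ (2 * q)) := by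
    intro s hs
    have := JJ_tent hq B b hb hB L hL (fun i => s i * R) (fun i => mul_nonneg (hs i).1 (by linarith))
    have e0 : (fun i (k : ZMod K) => s i * (R * tent L i k.val)) =
        fun i (k : ZMod K) => s i * R * tent L i k.val := by
      funext i k; ring
    rw [e0]; exact this
  refine minimax (JJ q B) (GG q B) (JJ_cont hq B) (GG_cont hq B) (JJ_deriv hq B hs) (JJ_abs hq B)
    (fun u i h k => GG_face B u i h k) R1 hR1 (fun i => r * (K * e i))
    (fun i => mul_pos hr (mul_pos hKr (he i))) hr2
    (fun i k => R * tent L i k.val) (fun i k => mul_nonneg (by linarith) (tent_nonneg _ _ _)) ?_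
    (n * M) ?_ ?_
  · intro i
    have h1 : r * (K * e i) ≤ R := (single_le_sum (f := fun i => r * (K * e i))
      (fun i _ => (mul_pos hr (mul_pos hKr (he i))).le) (mem_univ i)).trans (le_max_right _ _)
    refine h1.trans ?_
    rw [← mul_sum, sum_zmod (K := K) (fun m => tent L i m)]
    have h2 := tent_sum L i n i.2 1 one_pos
    simp only [Real.rpow_one] at h2
    have h3 : (1 : ℝ) ≤ L := by exact_mod_cast hL
    have h4 : (1 : ℝ) ≤ ∑ m ∈ range K, tent L i m := by nlinarith
    nlinarith
  · intro s hs
    refine (hJ s hs).trans ?_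
    refine (sum_le_sum fun i _ => hbd (s i * R) (mul_nonneg (hs i).1 (by linarith))).trans ?_
    simp [hM]
  · intro s hs i hi
    refine (hJ s hs).trans ?_
    rw [← add_sum_erase _ _ (mem_univ i)]
    have h1 : ∑ j ∈ univ.erase i, (a * (s j * R) ^ 2 - c * (s j * R) ^ (2 * q)) ≤ n * M := by
      refine (sum_le_sum fun i _ => hbd (s i * R) (mul_nonneg (hs i).1 (by linarith))).trans ?_
      rw [sum_const, nsmul_eq_mul]
      refine mul_le_mul_of_nonneg_right ?_ hM0
      have := card_le_univ (univ.erase i)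
      rw [Fintype.card_fin] at this
      exact_mod_cast this
    have h2 := hR0 R hRR0
    rw [hi, one_mul]
    linarith

lemma osc {n K : ℕ} [NeZero K] (u : Fin n → ZMod K → ℝ) (i : Fin n) (k l : ZMod K) :
    |u i k - u i l| ≤ Real.sqrt (K * QQ u) := by
  apply Real.le_sqrt_of_sq_le
  have h1 : ∀ m : ℕ, |u i (l + m) - u i l| ≤ ∑ j ∈ range m, |u i (l + j + 1) - u i (l + j)| := by
    intro m
    induction m with
    | zero => simp
    | succ m ih =>
      rw [sum_range_succ, Nat.cast_succ, ← add_assoc]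
      have := abs_sub_le (u i (l + m + 1)) (u i (l + m)) (u i l)
      linarith
  have h2 : ∑ j ∈ range (k - l).val, |u i (l + j + 1) - u i (l + j)| ≤
      ∑ j ∈ range K, |u i (l + j + 1) - u i (l + j)| :=
    sum_le_sum_of_subset_of_nonneg (range_subset_range.2 (ZMod.val_lt _).le) fun _ _ _ => abs_nonneg _
  have h3 : ∑ j ∈ range K, |u i (l + j + 1) - u i (l + j)| = ∑ k, |u i (k + 1) - u i k| := by
    rw [← sum_zmod (K := K) (fun j => |u i (l + j + 1) - u i (l + j)|)]
    simp only [ZMod.natCast_zmod_val]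
    exact Equiv.sum_comp (Equiv.addLeft l) (fun k => |u i (k + 1) - u i k|)
  have h4 := h1 (k - l).val
  rw [ZMod.natCast_zmod_val, add_sub_cancel] at h4
  have h5 := h4.trans (h2.trans h3.le)
  have h6 : (∑ k, |u i (k + 1) - u i k|) ^ 2 ≤ K * ∑ k, (u i (k + 1) - u i k) ^ 2 := by
    have := sq_sum_le_card_mul_sum_sq (s := (univ : Finset (ZMod K))) (f := fun k => |u i (k + 1) - u i k|)
    simpa [ZMod.card] using this
  have h7 : ∑ k, (u i (k + 1) - u i k) ^ 2 ≤ QQ u :=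
    single_le_sum (f := fun i => ∑ k, (u i (k + 1) - u i k) ^ 2)
      (fun _ _ => sum_nonneg fun _ _ => sq_nonneg _) (mem_univ i)
  calc |u i k - u i l| ^ 2 ≤ (∑ k, |u i (k + 1) - u i k|) ^ 2 :=
        pow_le_pow_left₀ (abs_nonneg _) h5 2
    _ ≤ _ := h6.trans (mul_le_mul_of_nonneg_left h7 (by positivity))

lemma rate {n : ℕ} (hn : 0 < n) (q b ε : ℝ) (hq : 1 < q) (hb : 0 < b) (hε : 0 < ε) :
    ∃ L : ℕ, 0 < L ∧ ((4 * n * L : ℕ) : ℝ) * ((n * (((4 * n * L : ℕ) : ℝ) / 2 *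
        ((((4 * n * L : ℕ) : ℝ) / 2) / (b * (L * (L : ℝ) ^ (2 * q)) / (2 * q))) ^ (2 / (2 * q - 2))))
        ) < ε := by
  set C : ℝ := 8 * n ^ 3 * (4 * n * q / b) ^ (2 / (2 * q - 2)) with hC
  have hn0 : (0 : ℝ) < n := by exact_mod_cast hn
  have ht : Filter.Tendsto (fun L : ℕ => C * (L : ℝ) ^ (-(2 / (q - 1)))) Filter.atTop (nhds (C * 0)) := by
    refine Filter.Tendsto.const_mul _ ?_
    exact (tendsto_rpow_neg_atTop (div_pos two_pos (by linarith))).comp tendsto_natCast_atTop_atTop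
  rw [mul_zero] at ht
  obtain ⟨L, hL1, hL2⟩ := ((ht.eventually (gt_mem_nhds hε)).and (Filter.eventually_gt_atTop 0)).exists
  refine ⟨L, hL2, lt_of_le_of_lt (le_of_eq ?_) hL1⟩
  have hL : (0 : ℝ) < L := by exact_mod_cast hL2
  have e1 : (((4 * n * L : ℕ) : ℝ) / 2) / (b * (L * (L : ℝ) ^ (2 * q)) / (2 * q))
      = (4 * n * q / b) * (L : ℝ) ^ (-(2 * q)) := by
    rw [Real.rpow_neg hL.le]
    have : (L : ℝ) ^ (2 * q) ≠ 0 := by positivity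
    push_cast
    field_simp
  rw [e1, Real.mul_rpow (by positivity) (by positivity), ← Real.rpow_mul hL.le]
  have e2 : (L : ℝ) ^ (-(2 / (q - 1))) = (L : ℝ) ^ 2 * (L : ℝ) ^ (-(2 * q) * (2 / (2 * q - 2))) := by
    rw [← Real.rpow_natCast, ← Real.rpow_add hL]
    congr 1
    have : q - 1 ≠ 0 := by linarith
    have h2 : 2 * q - 2 ≠ 0 := by linarith
    push_cast
    field_simp
    ring
  rw [e2, hC]
  push_cast
  ring

end LV

open Finset

namespace LV

lemma small_sol {n : ℕ} (hn : 0 < n) {q : ℝ} (hq : 1 < q) (B : Matrix (Fin n) (Fin n) ℝ) (hs : B.IsSymm)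
    (b : ℝ) (hb : 0 < b) (hB : ∀ i, b ≤ B i i)
    (κ : ℝ) (hκ : 0 < κ)
    (hBκ : ∀ d : Fin n → ℝ, (∀ i, 0 ≤ d i ∧ d i ≤ 1) → (∃ i, d i = 1) → ∃ i, κ ≤ |ff q B d i|)
    (κ1 : ℝ) (hκ1 : 0 < κ1)
    (hBκ1 : ∀ d y : Fin n → ℝ, (∀ i, 0 ≤ d i ∧ d i ≤ 1) → (∀ i, 0 ≤ y i ∧ y i ≤ 1) →
      (∀ i, |d i - y i| ≤ κ1) → ∀ i, |ff q B d i - ff q B y i| ≤ κ / 2)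
    (e : Fin n → ℝ) (he : ∀ i, 0 < e i) (hneg : ∑ i, ∑ j, B i j * e i ^ q * e j ^ q < 0)
    (ε : ℝ) (hε : 0 < ε) :
    ∃ (v : Fin n → ℤ → ℝ) (h : ℝ), 0 < h ∧ h < ε ∧ (∀ i k, 0 ≤ v i k ∧ v i k ≤ 1) ∧ (∃ i, v i 0 = 1) ∧
      ∀ i k, 2 * v i k - v i (k + 1) - v i (k - 1) = h ^ 2 * ff q B (fun j => v j k) i := by
  set η := ε ^ (1 / (q - 1)) with hη
  have hη0 : 0 < η := by positivity
  set cc := 1 / 2 - 1 / (2 * q) with hcc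
  have hcc0 : 0 < cc := by
    have : 1 / (2 * q) < 1 / 2 := one_div_lt_one_div_of_lt two_pos (by linarith)
    linarith
  obtain ⟨K, hKi, u, hu, hG, hJ0, hKJ⟩ : ∃ (K : ℕ) (_ : NeZero K) (u : Fin n → ZMod K → ℝ),
      (∀ i k, 0 ≤ u i k) ∧ GG q B u = 0 ∧ 0 < JJ q B u ∧ K * JJ q B u < cc * (κ1 * η) ^ 2 := by
    obtain ⟨L, hL, hLr⟩ := rate hn q b (cc * (κ1 * η) ^ 2) hq hb (by positivity)
    have hKpos : 0 < 4 * n * L := by positivity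
    have hNZ : NeZero (4 * n * L) := ⟨hKpos.ne'⟩
    obtain ⟨u, hu, hG, hJ0, hJ⟩ := lattice_sol hn hq B hs b hb hB κ hκ hBκ e he hneg L hL
    have hKr : (0 : ℝ) < (4 * n * L : ℕ) := by exact_mod_cast hKpos
    exact ⟨4 * n * L, hNZ, u, hu, hG, hJ0, (mul_le_mul_of_nonneg_left hJ hKr.le).trans_lt hLr⟩
  have hQW : QQ u - WW q B u = 0 := by
    rw [← sum_GG hq, hG]; simp
  have hJQ : JJ q B u = cc * QQ u := by
    unfold JJ
    rw [← sub_eq_zero.1 hQW, hcc]; ring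
  have hKQ : K * QQ u < (κ1 * η) ^ 2 := by
    have h1 := hKJ
    rw [hJQ] at h1
    have : K * (cc * QQ u) = cc * (K * QQ u) := by ring
    rw [this] at h1
    exact lt_of_mul_lt_mul_left h1 hcc0.le
  have hosc : ∀ i k l, |u i k - u i l| < κ1 * η := by
    intro i k l
    refine (osc u i k l).trans_lt ?_
    rw [Real.sqrt_lt' (by positivity)]
    exact hKQ
  have hu0 : u ≠ 0 := by
    rintro rfl
    rw [hJQ] at hJ0
    simp [QQ] at hJ0
  obtain ⟨i0, k0, hpos, -, hm⟩ := exists_max u hu hu0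
  set X := u i0 k0 with hX
  have hv01 : ∀ i k, 0 ≤ u i k / X ∧ u i k / X ≤ 1 := fun i k =>
    ⟨div_nonneg (hu _ _) hpos.le, (div_le_one hpos).2 (hm _ _)⟩
  have hff : ∀ k i, ff q B (fun j => u j k) i = X ^ (2 * q - 1) * ff q B (fun j => u j k / X) i := by
    intro k i
    have h4 := ff_smul hq B (fun j => u j k / X) (fun j => (hv01 j k).1) X hpos i
    simpa only [mul_div_cancel₀ _ hpos.ne'] using h4
  have hGe : ∀ i k, 2 * u i k - u i (k + 1) - u i (k - 1) = ff q B (fun j => u j k) i := by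
    intro i k
    have := congrFun (congrFun hG i) k
    simp only [GG, Pi.zero_apply] at this
    linarith
  have hXη : X < η := by
    by_contra hcon
    have hcon := not_lt.1 hcon
    obtain ⟨i, hi⟩ := hBκ (fun j => u j k0 / X) (fun j => hv01 j k0) ⟨i0, div_self hpos.ne'⟩
    have hclose : ∀ k, |ff q B (fun j => u j k / X) i - ff q B (fun j => u j k0 / X) i| ≤ κ / 2 := by
      intro k
      refine hBκ1 _ _ (fun j => hv01 j k) (fun j => hv01 j k0) (fun j => ?_) i
      rw [← sub_div, abs_div, abs_of_pos hpos, div_le_iff₀ hpos]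
      exact (hosc j k k0).le.trans (mul_le_mul_of_nonneg_left hcon hκ1.le)
    have hsum : ∑ k, ff q B (fun j => u j k / X) i = 0 := by
      have h1 : ∑ k, ff q B (fun j => u j k) i = 0 := by
        simp only [← hGe, sum_sub_distrib, ← mul_sum]
        have a1 := sum_shift (u i)
        have a2 := sum_shift (fun k => u i (k - 1))
        simp only [add_sub_cancel_right] at a2
        rw [a1, ← a2]; ring
      simp only [hff, ← mul_sum] at h1
      rcases mul_eq_zero.1 h1 with h | h
      · exact absurd h (by positivity)
      · exact h
    rcases le_total 0 (ff q B (fun j => u j k0 / X) i) with h0 | h0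
    · rw [abs_of_nonneg h0] at hi
      have : 0 < ∑ k, ff q B (fun j => u j k / X) i :=
        sum_pos (fun k _ => by linarith [(abs_le.1 (hclose k)).1]) univ_nonempty
      linarith
    · rw [abs_of_nonpos h0] at hi
      have : ∑ k, ff q B (fun j => u j k / X) i < 0 :=
        sum_neg (fun k _ => by linarith [(abs_le.1 (hclose k)).2]) univ_nonempty
      linarith
  refine ⟨fun i k => u i (k0 + (k : ZMod K)) / X, X ^ (q - 1), by positivity, ?_,
    fun i k => hv01 _ _, ⟨i0, ?_⟩, fun i k => ?_⟩
  · have h1 := Real.rpow_lt_rpow hpos.le hXη (by linarith : 0 < q - 1)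
    rwa [hη, ← Real.rpow_mul hε.le, one_div_mul_cancel (by linarith), Real.rpow_one] at h1
  · simp only [Int.cast_zero, add_zero]
    exact div_self hpos.ne'
  · have h1 := hGe i (k0 + (k : ZMod K))
    rw [hff] at h1
    have h2 : X ^ (2 * q - 1) = (X ^ (q - 1)) ^ 2 * X := by
      rw [← Real.rpow_natCast, ← Real.rpow_mul hpos.le, ← Real.rpow_add_one hpos.ne']
      congr 1; push_cast; ring
    rw [h2] at h1
    push_cast
    rw [← add_assoc, ← add_sub_assoc]
    field_simp
    linarith

end LV

open Finset

namespace LV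

lemma tele_aux (a : ℤ → ℝ) (b ε : ℝ) (k : ℤ) (m : ℕ)
    (h : ∀ j, k ≤ j → j < k + m → |a (j + 1) - a j - b| ≤ ε) :
    |a (k + m) - a k - m * b| ≤ m * ε := by
  induction m with
  | zero => simp
  | succ m ih =>
    have h1 := ih (fun j h1 h2 => h j h1 (by push_cast; omega))
    have h2 := h (k + m) (by omega) (by push_cast; omega)
    push_cast
    rw [← add_assoc]
    have e : a (k + m + 1) - a k - (m + 1) * b
      = (a (k + m + 1) - a (k + m) - b) + (a (k + m) - a k - m * b) := by ring
    rw [e]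
    refine (abs_add_le _ _).trans ?_
    linarith

lemma tele (a : ℤ → ℝ) (b ε : ℝ) (k l : ℤ)
    (h : ∀ j, min k l ≤ j → j < max k l → |a (j + 1) - a j - b| ≤ ε) :
    |a l - a k - (l - k) * b| ≤ |(l : ℝ) - k| * ε := by
  have key : ∀ k l : ℤ, k ≤ l → (∀ j, k ≤ j → j < l → |a (j + 1) - a j - b| ≤ ε) →
      |a l - a k - (l - k) * b| ≤ |(l : ℝ) - k| * ε := by
    intro k l hkl h
    obtain ⟨m, rfl⟩ := Int.le.dest hkl
    have := tele_aux a b ε k m h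
    simpa using this
  rcases le_total k l with hkl | hkl
  · rw [min_eq_left hkl, max_eq_right hkl] at h
    exact key k l hkl h
  · rw [min_eq_right hkl, max_eq_left hkl] at h
    have := key l k hkl h
    rw [abs_sub_comm (k : ℝ) l] at this
    rw [← abs_neg]
    convert this using 2
    ring

lemma disc_D (v : ℤ → ℝ) (h C : ℝ) (hh : 0 < h)
    (hv : ∀ k, |2 * v k - v (k + 1) - v (k - 1)| ≤ h ^ 2 * C) (k l : ℤ) :
    |(v (l + 1) - v l) / h - (v (k + 1) - v k) / h| ≤ |(l : ℝ) - k| * (h * C) := by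
  have := tele (fun j => (v (j + 1) - v j) / h) 0 (h * C) k l (fun j _ _ => by
    have h1 := hv (j + 1)
    rw [add_sub_cancel_right] at h1
    beta_reduce
    rw [sub_zero, ← sub_div, abs_div, abs_of_pos hh, div_le_iff₀ hh, ← abs_neg]
    refine le_trans (le_of_eq ?_) (h1.trans (le_of_eq (by ring)))
    congr 1; ring)
  simpa using this

lemma disc_v (v : ℤ → ℝ) (h C : ℝ) (hh : 0 < h) (hC : 0 ≤ C)
    (hv : ∀ k, |2 * v k - v (k + 1) - v (k - 1)| ≤ h ^ 2 * C) (k l : ℤ) :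
    |v l - v k - (l - k) * h * ((v (k + 1) - v k) / h)| ≤ C * (((l : ℝ) - k) * h) ^ 2 := by
  have := tele v (h * ((v (k + 1) - v k) / h)) (|(l : ℝ) - k| * (h ^ 2 * C)) k l (fun j h1 h2 => by
    have h3 := disc_D v h C hh hv k j
    have h4 : |(j : ℝ) - k| ≤ |(l : ℝ) - k| := by
      rcases le_total k l with hkl | hkl
      · rw [min_eq_left hkl] at h1
        rw [max_eq_right hkl] at h2
        have a1 : (k : ℝ) ≤ j := by exact_mod_cast h1
        have a2 : (j : ℝ) ≤ l := by exact_mod_cast h2.le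
        rw [abs_of_nonneg (by linarith), abs_of_nonneg (by linarith)]; linarith
      · rw [min_eq_right hkl] at h1
        rw [max_eq_left hkl] at h2
        have a1 : (l : ℝ) ≤ j := by exact_mod_cast h1
        have a2 : (j : ℝ) ≤ k := by exact_mod_cast h2.le
        rw [abs_of_nonpos (by linarith), abs_of_nonpos (by linarith)]; linarith
    have h5 : v (j + 1) - v j - h * ((v (k + 1) - v k) / h)
        = h * ((v (j + 1) - v j) / h - (v (k + 1) - v k) / h) := by field_simp
    rw [h5, abs_mul, abs_of_pos hh]
    calc h * |(v (j + 1) - v j) / h - (v (k + 1) - v k) / h| ≤ h * (|(j : ℝ) - k| * (h * C)) :=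
          mul_le_mul_of_nonneg_left h3 hh.le
      _ ≤ h * (|(l : ℝ) - k| * (h * C)) := by gcongr
      _ = _ := by ring)
  rw [← mul_assoc] at this
  refine this.trans (le_of_eq ?_)
  rw [mul_pow, ← sq_abs ((l : ℝ) - k)]; ring

lemma disc_bd (v : ℤ → ℝ) (h C : ℝ) (hh : 0 < h) (hh1 : h ≤ 1) (hC : 0 ≤ C)
    (h01 : ∀ k, 0 ≤ v k ∧ v k ≤ 1)
    (hv : ∀ k, |2 * v k - v (k + 1) - v (k - 1)| ≤ h ^ 2 * C) (k : ℤ) :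
    |(v (k + 1) - v k) / h| ≤ 1 + 4 * C := by
  set m : ℤ := ⌈1 / h⌉ with hm
  have m1 : 1 ≤ m * h := by rw [← div_le_iff₀ hh]; exact Int.le_ceil _
  have m2 : m * h ≤ 2 := by
    have := (Int.ceil_lt_add_one (1 / h)).le
    have h2 := mul_le_mul_of_nonneg_right this hh.le
    rw [add_mul, div_mul_cancel₀ _ hh.ne'] at h2
    linarith
  have h3 := disc_v v h C hh hC hv k (k + m)
  push_cast at h3
  rw [add_sub_cancel_left] at h3
  set D := (v (k + 1) - v k) / h with hD
  have h4 : C * (m * h) ^ 2 ≤ 4 * C := by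
    have h9 : (m * h) ^ 2 ≤ 4 := by nlinarith
    nlinarith
  have h5 := abs_le.1 (h3.trans h4)
  have h6 := h01 k
  have h7 := h01 (k + m)
  have h8 : |m * h * D| ≤ 1 + 4 * C := by
    rw [abs_le]; constructor <;> linarith [h5.1, h5.2, h6.1, h6.2, h7.1, h7.2]
  rw [abs_mul, abs_of_nonneg (by linarith)] at h8
  nlinarith [abs_nonneg D]

lemma ult_lim (𝓤 : Ultrafilter ℕ) (a : ℕ → ℝ) (C : ℝ) (h : ∀ L, |a L| ≤ C) :
    ∃ l, Filter.Tendsto a 𝓤 (nhds l) := by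
  obtain ⟨l, -, hl⟩ := (isCompact_Icc (a := -C) (b := C)).ultrafilter_le_nhds (𝓤.map a) (by
    rw [Filter.le_principal_iff]
    exact Filter.Eventually.of_forall (f := (𝓤 : Filter ℕ)) (p := fun L => a L ∈ Set.Icc (-C) C)
      fun L => abs_le.1 (h L))
  exact ⟨l, hl⟩

theorem limit {n : ℕ} (f : (Fin n → ℝ) → Fin n → ℝ) (hf : Continuous f)
    (H : ∀ ε : ℝ, 0 < ε → ∃ (v : Fin n → ℤ → ℝ) (h : ℝ), 0 < h ∧ h < ε ∧
      (∀ i k, 0 ≤ v i k ∧ v i k ≤ 1) ∧ (∃ i, v i 0 = 1) ∧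
      ∀ i k, 2 * v i k - v i (k + 1) - v i (k - 1) = h ^ 2 * f (fun j => v j k) i) :
    ∃ U P : Fin n → ℝ → ℝ, (∀ i x, HasDerivAt (U i) (P i x) x) ∧
      (∀ i x, HasDerivAt (P i) (-f (fun j => U j x) i) x) ∧ (∀ i x, 0 ≤ U i x) ∧
      1 ≤ ∑ i, U i 0 := by
  have hcub : IsCompact (Set.Icc (0 : Fin n → ℝ) 1) := isCompact_Icc
  obtain ⟨C, hC0, hC⟩ : ∃ C : ℝ, 0 ≤ C ∧ ∀ d : Fin n → ℝ, (∀ i, 0 ≤ d i ∧ d i ≤ 1) → ∀ i, |f d i| ≤ C := by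
    obtain ⟨C, hC⟩ := hcub.exists_bound_of_continuousOn hf.continuousOn
    refine ⟨|C|, abs_nonneg _, fun d hd i => ?_⟩
    have := hC d ⟨fun i => (hd i).1, fun i => (hd i).2⟩
    exact (norm_le_pi_norm (f d) i).trans (this.trans (le_abs_self _))
  have huc : ∀ ε > 0, ∃ δ > 0, ∀ d y : Fin n → ℝ, (∀ i, 0 ≤ d i ∧ d i ≤ 1) → (∀ i, 0 ≤ y i ∧ y i ≤ 1) →
      (∀ i, |d i - y i| < δ) → ∀ i, |f d i - f y i| ≤ ε := by
    intro ε hε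
    have := hcub.uniformContinuousOn_of_continuous hf.continuousOn
    rw [Metric.uniformContinuousOn_iff] at this
    obtain ⟨δ, hδ, hh⟩ := this ε hε
    refine ⟨δ, hδ, fun d y hd hy hdy i => ?_⟩
    have h1 := hh d ⟨fun i => (hd i).1, fun i => (hd i).2⟩ y ⟨fun i => (hy i).1, fun i => (hy i).2⟩
      ((dist_pi_lt_iff hδ).2 fun i => by rw [Real.dist_eq]; exact hdy i)
    rw [← Real.dist_eq]
    exact (dist_le_pi_dist _ _ i).trans h1.le
  choose v h hh0 hh1 h01 hone heq using fun L : ℕ => H (1 / ((L : ℝ) + 1)) (by positivity)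
  have hle1 : ∀ L, h L ≤ 1 := fun L => (hh1 L).le.trans (by
    rw [div_le_one (by positivity)]; linarith [(Nat.cast_nonneg L : (0 : ℝ) ≤ L)])
  have hv : ∀ L i k, |2 * v L i k - v L i (k + 1) - v L i (k - 1)| ≤ h L ^ 2 * C := by
    intro L i k
    rw [heq, abs_mul, abs_of_nonneg (sq_nonneg _)]
    exact mul_le_mul_of_nonneg_left (hC _ (fun j => h01 L j k) i) (sq_nonneg _)
  set 𝓤 : Ultrafilter ℕ := Filter.hyperfilter ℕ with h𝓤
  have hU : (𝓤 : Filter ℕ) ≤ Filter.atTop := by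
    rw [← Nat.cofinite_eq_atTop]; exact Filter.hyperfilter_le_cofinite
  have hht : Filter.Tendsto h 𝓤 (nhds 0) := by
    refine Filter.Tendsto.mono_left ?_ hU
    exact squeeze_zero (fun L => (hh0 L).le) (fun L => (hh1 L).le) tendsto_one_div_add_atTop_nhds_zero_nat
  set D : ℕ → Fin n → ℤ → ℝ := fun L i k => (v L i (k + 1) - v L i k) / h L with hD
  set kk : ℝ → ℕ → ℤ := fun x L => ⌊x / h L⌋ with hkk
  have hbd : ∀ L i k, |D L i k| ≤ 1 + 4 * C := fun L i k =>
    disc_bd (v L i) (h L) C (hh0 L) (hle1 L) hC0 (h01 L i) (hv L i) k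
  choose U hUl using fun (i : Fin n) (x : ℝ) => ult_lim 𝓤 (fun L => v L i (kk x L)) 1
    (fun L => abs_le.2 ⟨by linarith [(h01 L i (kk x L)).1], (h01 L i (kk x L)).2⟩)
  choose P hPl using fun (i : Fin n) (x : ℝ) => ult_lim 𝓤 (fun L => D L i (kk x L)) (1 + 4 * C)
    (fun L => hbd L i (kk x L))
  have hkh : ∀ x, Filter.Tendsto (fun L => (kk x L : ℝ) * h L) 𝓤 (nhds x) := by
    intro x
    have h1 : Filter.Tendsto (fun L => x - h L) 𝓤 (nhds x) := by
      simpa using hht.const_sub x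
    refine tendsto_of_tendsto_of_tendsto_of_le_of_le h1 tendsto_const_nhds (fun L => ?_) (fun L => ?_)
    · have := (Int.sub_one_lt_floor (x / h L)).le
      have h2 := mul_le_mul_of_nonneg_right this (hh0 L).le
      rw [sub_mul, div_mul_cancel₀ _ (hh0 L).ne', one_mul] at h2
      exact h2
    · have := Int.floor_le (x / h L)
      have h2 := mul_le_mul_of_nonneg_right this (hh0 L).le
      rwa [div_mul_cancel₀ _ (hh0 L).ne'] at h2
  have hdiff : ∀ x y, Filter.Tendsto (fun L => ((kk y L : ℝ) - kk x L) * h L) 𝓤 (nhds (y - x)) := by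
    intro x y
    simpa only [sub_mul] using (hkh y).sub (hkh x)
  have c2 : ∀ i x y, |U i y - U i x - (y - x) * P i x| ≤ C * (y - x) ^ 2 := by
    intro i x y
    refine le_of_tendsto_of_tendsto (b := (𝓤 : Filter ℕ))
      (((hUl i y).sub (hUl i x)).sub ((hdiff x y).mul (hPl i x))).abs
      (((hdiff x y).pow 2).const_mul C) (Filter.Eventually.of_forall fun L => ?_)
    exact disc_v (v L i) (h L) C (hh0 L) hC0 (hv L i) (kk x L) (kk y L)
  have hfl : ∀ i x, Filter.Tendsto (fun L => f (fun j => v L j (kk x L)) i) 𝓤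
      (nhds (f (fun j => U j x) i)) := by
    intro i x
    have h1 : Filter.Tendsto (fun L => fun j => v L j (kk x L)) 𝓤 (nhds (fun j => U j x)) :=
      tendsto_pi_nhds.2 fun j => hUl j x
    exact (((continuous_apply i).comp hf).tendsto _).comp h1
  have c3 : ∀ ε > 0, ∃ δ > 0, ∀ i x y, |y - x| < δ →
      |P i y - P i x + (y - x) * f (fun j => U j x) i| ≤ |y - x| * ε := by
    intro ε hε
    obtain ⟨δ, hδ, hfδ⟩ := huc ε hε
    have hC1 : 0 < 1 + 4 * C := by linarith
    refine ⟨δ / (1 + 4 * C), by positivity, fun i x y hxy => ?_⟩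
    have hlim2 : Filter.Tendsto (fun L => (|((kk y L : ℝ) - kk x L) * h L| + h L) * (1 + 4 * C)) 𝓤
        (nhds ((|y - x| + 0) * (1 + 4 * C))) := ((hdiff x y).abs.add hht).mul_const _
    have hev := hlim2.eventually (gt_mem_nhds (show (|y - x| + 0) * (1 + 4 * C) < δ by
      rw [add_zero]; rwa [lt_div_iff₀ hC1] at hxy))
    refine le_of_tendsto_of_tendsto (b := (𝓤 : Filter ℕ))
      (((hPl i y).sub (hPl i x)).add ((hdiff x y).mul (hfl i x))).abs
      ((hdiff x y).abs.mul_const ε) (hev.mono fun L hL => ?_)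
    set k := kk x L
    set l := kk y L
    have hstep : ∀ j : ℤ, ∀ i, |v L i j - v L i k| ≤ |(j : ℝ) - k| * (h L * (1 + 4 * C)) := by
      intro j i
      have := tele (v L i) 0 (h L * (1 + 4 * C)) k j (fun m _ _ => by
        have h1 := hbd L i m
        rw [sub_zero]
        simp only [hD] at h1
        rw [abs_div, abs_of_pos (hh0 L), div_le_iff₀ (hh0 L)] at h1
        linarith)
      simpa using this
    have := tele (D L i) (-(h L * f (fun j => v L j k) i)) (h L * ε) k l (fun j h1 h2 => by
      have e1 : D L i (j + 1) - D L i j = -(h L * f (fun m => v L m (j + 1)) i) := by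
        have := heq L i (j + 1)
        rw [add_sub_cancel_right] at this
        simp only [hD]
        have hne := (hh0 L).ne'
        field_simp
        linarith
      rw [e1]
      have e2 : -(h L * f (fun m => v L m (j + 1)) i) - -(h L * f (fun j => v L j k) i)
        = h L * (f (fun j => v L j k) i - f (fun m => v L m (j + 1)) i) := by ring
      rw [e2, abs_mul, abs_of_pos (hh0 L)]
      refine mul_le_mul_of_nonneg_left ?_ (hh0 L).le
      rw [abs_sub_comm]
      refine hfδ _ _ (fun m => h01 L m _) (fun m => h01 L m _) (fun m => ?_) i
      refine (hstep (j + 1) m).trans_lt (lt_of_le_of_lt ?_ hL)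
      rw [abs_mul, abs_of_pos (hh0 L)]
      have h4 : |((j + 1 : ℤ) : ℝ) - k| ≤ |(l : ℝ) - k| + 1 := by
        push_cast
        rcases le_total k l with hkl | hkl
        · rw [min_eq_left hkl] at h1
          rw [max_eq_right hkl] at h2
          have a1 : (k : ℝ) ≤ j := by exact_mod_cast h1
          have a2 : (j : ℝ) ≤ l := by exact_mod_cast h2.le
          rw [abs_of_nonneg (by linarith), abs_of_nonneg (by linarith)]; linarith
        · rw [min_eq_right hkl] at h1
          rw [max_eq_left hkl] at h2
          have a1 : (l : ℝ) ≤ j := by exact_mod_cast h1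
          have a2 : (j : ℝ) + 1 ≤ k := by exact_mod_cast h2
          rw [abs_of_nonpos (by linarith), abs_of_nonpos (by linarith)]; linarith
      calc |((j + 1 : ℤ) : ℝ) - k| * (h L * (1 + 4 * C))
          ≤ (|(l : ℝ) - k| + 1) * (h L * (1 + 4 * C)) :=
            mul_le_mul_of_nonneg_right h4 (mul_nonneg (hh0 L).le hC1.le)
        _ = _ := by ring)
    show |D L i l - D L i k + ((l : ℝ) - k) * h L * f (fun j => v L j k) i| ≤ |((l : ℝ) - k) * h L| * ε
    rw [abs_mul ((l : ℝ) - k), abs_of_pos (hh0 L), mul_assoc |(l : ℝ) - k|]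
    refine le_trans (le_of_eq ?_) this
    congr 1; ring
  refine ⟨U, P, fun i x => ?_, fun i x => ?_, fun i x => ?_, ?_⟩
  · rw [hasDerivAt_iff_isLittleO, Asymptotics.isLittleO_iff]
    intro c hc
    have hev : ∀ᶠ y in nhds x, |y - x| < c / (C + 1) := by
      have := Metric.ball_mem_nhds x (show 0 < c / (C + 1) by positivity)
      filter_upwards [this] with y hy
      rwa [Metric.mem_ball, Real.dist_eq] at hy
    filter_upwards [hev] with y hy
    rw [lt_div_iff₀ (by positivity)] at hy
    simp only [Real.norm_eq_abs, smul_eq_mul]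
    refine (c2 i x y).trans ?_
    rw [← sq_abs]
    nlinarith [abs_nonneg (y - x), sq_nonneg |y - x|]
  · rw [hasDerivAt_iff_isLittleO, Asymptotics.isLittleO_iff]
    intro c hc
    obtain ⟨δ, hδ, h3⟩ := c3 c hc
    filter_upwards [Metric.ball_mem_nhds x hδ] with y hy
    rw [Metric.mem_ball, Real.dist_eq] at hy
    simp only [Real.norm_eq_abs, smul_eq_mul]
    refine le_trans (le_of_eq ?_) ((h3 i x y hy).trans (le_of_eq (mul_comm _ _)))
    congr 1; ring
  · exact ge_of_tendsto' (hUl i x) (fun L => (h01 L i _).1)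
  · refine ge_of_tendsto' (tendsto_finsetSum _ fun i _ => hUl i 0) (fun L => ?_)
    obtain ⟨i, hi⟩ := hone L
    have h0 : kk 0 L = 0 := by simp [hkk]
    rw [h0, ← hi]
    exact single_le_sum (f := fun i => v L i 0) (fun j _ => (h01 L j 0).1) (mem_univ i)

end LV


namespace LV

lemma quad_expand {n : ℕ} (B : Matrix (Fin n) (Fin n) ℝ) (hs : B.IsSymm) (c : Fin n → ℝ) (i : Fin n)
    (t : ℝ) : ∑ a, ∑ b, B a b * (c + t • (Pi.single i (1 : ℝ) : Fin n → ℝ)) a * (c + t • (Pi.single i (1 : ℝ) : Fin n → ℝ)) b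
      = ∑ a, ∑ b, B a b * c a * c b + 2 * t * ∑ j, B i j * c j + t ^ 2 * B i i := by
  set d : Fin n → ℝ := Pi.single i (1 : ℝ) with hd
  have e1 : ∀ a b, B a b * (c + t • d) a * (c + t • d) b
      = B a b * c a * c b + t * (B a b * c b) * d a + t * (B a b * c a) * d b
        + t ^ 2 * (B a b * d b) * d a := by
    intro a b
    simp only [Pi.add_apply, Pi.smul_apply, smul_eq_mul]; ring
  simp only [e1, sum_add_distrib, ← sum_mul, ← mul_sum]
  have e2 : ∀ g : Fin n → ℝ, ∑ a, g a * d a = g i := by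
    intro g
    rw [sum_eq_single i]
    · simp [hd]
    · intro b _ hb; simp [hd, hb]
    · intro h; exact absurd (mem_univ i) h
  rw [e2 (fun a => t * ∑ b, B a b * c b), e2 (fun a => t ^ 2 * ∑ b, B a b * d b)]
  have e3 : ∑ a, ∑ b, t * (B a b * c a) * d b = t * ∑ j, B i j * c j := by
    rw [sum_comm]
    simp only [← sum_mul]
    rw [e2 (fun b => ∑ a, t * (B a b * c a)), ← mul_sum]
    congr 1
    refine sum_congr rfl fun j _ => ?_
    rw [hs.apply]
  rw [e3, e2 (fun b => B i b)]
  ring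

lemma neg_exists {n : ℕ} (B : Matrix (Fin n) (Fin n) ℝ) (hs : B.IsSymm)
    (hdiag : ∀ i, 0 ≤ B i i)
    (hncop : ¬ (∀ c : Fin n → ℝ, (∀ i, 0 ≤ c i) → c ≠ 0 → 0 < ∑ i, ∑ j, B i j * c i * c j))
    (hno : ∀ c : Fin n → ℝ, (∀ i, 0 ≤ c i) → (∀ i, (∑ j, B i j * c j) * c i = 0) → c = 0) :
    ∃ c : Fin n → ℝ, (∀ i, 0 < c i) ∧ ∑ i, ∑ j, B i j * c i * c j < 0 := by
  push Not at hncop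
  obtain ⟨c, hc, hc0, hq⟩ := hncop
  obtain ⟨c, hc, hq⟩ : ∃ c : Fin n → ℝ, (∀ i, 0 ≤ c i) ∧ ∑ i, ∑ j, B i j * c i * c j < 0 := by
    by_contra hcon
    push Not at hcon
    have hq0 : ∑ i, ∑ j, B i j * c i * c j = 0 := le_antisymm hq (hcon c hc)
    refine hc0 (hno c hc fun i => ?_)
    by_contra hne
    set g := ∑ j, B i j * c j with hg
    have hg0 : g ≠ 0 := fun h => hne (by rw [h, zero_mul])
    have hci : 0 < c i := lt_of_le_of_ne (hc i) fun h => hne (by rw [← h, mul_zero])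
    have hbi := hdiag i
    set s := min (c i / (|g| + 1)) (1 / (B i i + 1)) with hsd
    have hs0 : 0 < s := lt_min (by positivity) (by positivity)
    have hs1 : s * |g| ≤ c i := by
      have := min_le_left (c i / (|g| + 1)) (1 / (B i i + 1))
      rw [← hsd, le_div_iff₀ (by positivity)] at this
      nlinarith
    have hs2 : s * B i i ≤ 1 := by
      have := min_le_right (c i / (|g| + 1)) (1 / (B i i + 1))
      rw [← hsd, le_div_iff₀ (by positivity)] at this
      nlinarith
    have h1 := hcon (c + (-(s * g)) • (Pi.single i (1 : ℝ) : Fin n → ℝ)) (fun a => by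
      by_cases ha : a = i
      · subst ha
        simp only [Pi.add_apply, Pi.smul_apply, Pi.single_eq_same, smul_eq_mul, mul_one]
        nlinarith [le_abs_self g]
      · simp [ha, hc a])
    rw [quad_expand B hs c i, hq0, ← hg] at h1
    have h2 : 0 < s * g ^ 2 := by positivity
    nlinarith
  have hcont : Continuous (fun t : ℝ => ∑ i, ∑ j, B i j * (c i + t) * (c j + t)) := by fun_prop
  have hev : ∀ᶠ t in nhdsWithin (0 : ℝ) (Set.Ioi 0),
      ∑ i, ∑ j, B i j * (c i + t) * (c j + t) < 0 := by
    refine Filter.Eventually.filter_mono nhdsWithin_le_nhds ?_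
    exact (hcont.tendsto 0).eventually (gt_mem_nhds (by simpa using hq))
  obtain ⟨t, ht, ht0⟩ := (hev.and self_mem_nhdsWithin).exists
  exact ⟨fun i => c i + t, fun i => add_pos_of_nonneg_of_pos (hc i) ht0, ht⟩

lemma consts {n : ℕ} (f : (Fin n → ℝ) → Fin n → ℝ) (hf : Continuous f)
    (h0 : ∀ d : Fin n → ℝ, (∀ i, 0 ≤ d i) → f d = 0 → d = 0) :
    ∃ κ > 0, (∀ d : Fin n → ℝ, (∀ i, 0 ≤ d i ∧ d i ≤ 1) → (∃ i, d i = 1) → ∃ i, κ ≤ |f d i|) ∧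
    ∃ κ1 > 0, (∀ d y : Fin n → ℝ, (∀ i, 0 ≤ d i ∧ d i ≤ 1) → (∀ i, 0 ≤ y i ∧ y i ≤ 1) →
      (∀ i, |d i - y i| ≤ κ1) → ∀ i, |f d i - f y i| ≤ κ / 2) := by
  have hcub : IsCompact (Set.Icc (0 : Fin n → ℝ) 1) := isCompact_Icc
  obtain ⟨κ, hκ, h1⟩ : ∃ κ > 0, (∀ d : Fin n → ℝ, (∀ i, 0 ≤ d i ∧ d i ≤ 1) → (∃ i, d i = 1) →
      ∃ i, κ ≤ |f d i|) := by
    have hcl : IsClosed (⋃ i : Fin n, {d : Fin n → ℝ | d i = 1}) :=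
      isClosed_iUnion_of_finite fun i => isClosed_eq (continuous_apply i) continuous_const
    have hcp := hcub.inter_right hcl
    have main : ∃ κ > 0, ∀ d ∈ Set.Icc (0 : Fin n → ℝ) 1 ∩ ⋃ i : Fin n, {d : Fin n → ℝ | d i = 1},
        κ ≤ ‖f d‖ := by
      rcases Set.eq_empty_or_nonempty (Set.Icc (0 : Fin n → ℝ) 1 ∩ ⋃ i : Fin n, {d : Fin n → ℝ | d i = 1})
        with he | hne
      · exact ⟨1, one_pos, fun d hd => by rw [he] at hd; exact hd.elim⟩
      · obtain ⟨d0, hd0, hmin⟩ := hcp.exists_isMinOn hne hf.norm.continuousOn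
        refine ⟨‖f d0‖, norm_pos_iff.2 fun hz => ?_, fun d hd => hmin hd⟩
        have h2 := h0 d0 (fun i => hd0.1.1 i) hz
        obtain ⟨i, hi⟩ := Set.mem_iUnion.1 hd0.2
        have hi : d0 i = 1 := hi
        rw [h2] at hi
        simp at hi
    obtain ⟨κ, hκ, hm⟩ := main
    refine ⟨κ, hκ, fun d hd ⟨i, hi⟩ => ?_⟩
    by_contra hcon
    push Not at hcon
    have h3 := hm d ⟨⟨fun i => (hd i).1, fun i => (hd i).2⟩, Set.mem_iUnion.2 ⟨i, hi⟩⟩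
    have h4 : ‖f d‖ < κ := (pi_norm_lt_iff hκ).2 fun i => by rw [Real.norm_eq_abs]; exact hcon i
    linarith
  refine ⟨κ, hκ, h1, ?_⟩
  have := hcub.uniformContinuousOn_of_continuous hf.continuousOn
  rw [Metric.uniformContinuousOn_iff] at this
  obtain ⟨δ, hδ, hh⟩ := this (κ / 2) (by positivity)
  refine ⟨δ / 2, by positivity, fun d y hd hy hdy i => ?_⟩
  have h1 := hh d ⟨fun i => (hd i).1, fun i => (hd i).2⟩ y ⟨fun i => (hy i).1, fun i => (hy i).2⟩
    ((dist_pi_lt_iff hδ).2 fun i => by rw [Real.dist_eq]; exact (hdy i).trans_lt (by linarith))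
  rw [← Real.dist_eq]
  exact (dist_le_pi_dist _ _ i).trans h1.le

lemma fderiv_coord {N : ℕ} (i0 : Fin N) (g g' : ℝ → ℝ) (hg : ∀ x, HasDerivAt g (g' x) x)
    (y w : Fin N → ℝ) : fderiv ℝ (fun z : Fin N → ℝ => g (z i0)) y w = g' (y i0) * w i0 := by
  have h1 : HasFDerivAt (fun z : Fin N → ℝ => z i0) (ContinuousLinearMap.proj (R := ℝ) i0) y :=
    (ContinuousLinearMap.proj (R := ℝ) (φ := fun _ : Fin N => ℝ) i0).hasFDerivAt
  have h2 := (hg (y i0)).comp_hasFDerivAt y h1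
  have h3 := h2.fderiv
  have h4 : fderiv ℝ (fun z : Fin N → ℝ => g (z i0)) y = g' (y i0) • ContinuousLinearMap.proj (R := ℝ) i0 := h3
  rw [h4]; simp

lemma laplacian_coord {N : ℕ} (i0 : Fin N) (g g' g'' : ℝ → ℝ) (hg : ∀ x, HasDerivAt g (g' x) x)
    (hg' : ∀ x, HasDerivAt g' (g'' x) x) (x : Fin N → ℝ) :
    laplacian (fun z : Fin N → ℝ => g (z i0)) x = g'' (x i0) := by
  unfold laplacian
  simp only [fderiv_coord i0 g g' hg]
  have : ∀ i : Fin N, fderiv ℝ (fun y : Fin N → ℝ => g' (y i0) * (Pi.single i 1 : Fin N → ℝ) i0) x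
      (Pi.single i 1) = g'' (x i0) * (Pi.single i 1 : Fin N → ℝ) i0 * (Pi.single i 1 : Fin N → ℝ) i0 :=
    fun i => fderiv_coord i0 (fun t => g' t * (Pi.single i 1 : Fin N → ℝ) i0)
      (fun t => g'' t * (Pi.single i 1 : Fin N → ℝ) i0) (fun t => (hg' t).mul_const _) x _
  simp only [this]
  rw [sum_eq_single i0]
  · simp
  · intro b _ hb; simp [Pi.single_apply, hb.symm]
  · intro h; exact absurd (mem_univ i0) h

lemma contDiff_two (g g' g'' : ℝ → ℝ) (hg : ∀ x, HasDerivAt g (g' x) x)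
    (hg' : ∀ x, HasDerivAt g' (g'' x) x) (hc : Continuous g'') : ContDiff ℝ 2 g := by
  have e1 : deriv g = g' := funext fun x => (hg x).deriv
  have e2 : deriv g' = g'' := funext fun x => (hg' x).deriv
  have h1 : ContDiff ℝ 1 g' := by
    rw [contDiff_one_iff_deriv, e2]
    exact ⟨fun x => (hg' x).differentiableAt, hc⟩
  have : (2 : WithTop ℕ∞) = 1 + 1 := by norm_num
  rw [this, contDiff_succ_iff_deriv, e1]
  exact ⟨fun x => (hg x).differentiableAt, by simp, h1⟩

end LV

theorem stmt_8 (N n : ℕ) (hN1 : 1 ≤ N) (p : ℝ) (hp : 2 < p)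
    (hpN : 3 ≤ N → p < 2 * N / (N - 2))
    (B : Matrix (Fin n) (Fin n) ℝ) (hsym : B.IsSymm)
    (hdiag : ∀ i, 0 ≤ B i i)
    (hncop : ¬ (∀ c : Fin n → ℝ, (∀ i, 0 ≤ c i) → c ≠ 0 → 0 < ∑ i, ∑ j, B i j * c i * c j)) :
    ∃ u : Fin n → (Fin N → ℝ) → ℝ,
      (∀ i, ContDiff ℝ 2 (u i)) ∧
      (∀ i x, 0 ≤ u i x) ∧
      (∀ i x, -laplacian (u i) x =
        ∑ j, B i j * (u j x) ^ (p / 2) * (u i x) ^ (p / 2 - 1)) ∧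
      (∃ i, u i ≠ 0) := by
  have hq : 1 < p / 2 := by linarith
  set q := p / 2 with hqd
  have hq0 : q ≠ 0 := by linarith
  by_cases hno : ∀ c : Fin n → ℝ, (∀ i, 0 ≤ c i) → (∀ i, (∑ j, B i j * c j) * c i = 0) → c = 0
  · have hn : 0 < n := by
      by_contra h
      have : n = 0 := by omega
      subst this
      exact hncop fun c _ hc => absurd (Subsingleton.elim _ _) hc
    have hpos : ∀ i, 0 < B i i := by
      intro i
      refine lt_of_le_of_ne (hdiag i) fun h => ?_
      have h1 := hno (Pi.single i 1) (fun j => by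
        by_cases hj : j = i
        · subst hj; simp
        · simp [hj]) (fun j => by
        by_cases hj : j = i
        · subst hj
          rw [sum_eq_single j]
          · simp [← h]
          · intro b _ hb; simp [hb]
          · intro hh; exact absurd (mem_univ j) hh
        · simp [hj])
      have h2 := congrFun h1 i
      simp at h2
    obtain ⟨b, hb, hBb⟩ : ∃ b > 0, ∀ i, b ≤ B i i := by
      have hne : Nonempty (Fin n) := ⟨⟨0, hn⟩⟩
      obtain ⟨i, -, hi⟩ := exists_min_image (univ : Finset (Fin n)) (fun i => B i i) univ_nonempty
      exact ⟨B i i, hpos i, fun j => hi j (mem_univ j)⟩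
    obtain ⟨c, hc, hcneg⟩ := LV.neg_exists B hsym hdiag hncop hno
    obtain ⟨κ, hκ, hBκ, κ1, hκ1, hBκ1⟩ := LV.consts (LV.ff q B) (LV.ff_cont hq B) (by
      intro d hd hz
      have h1 := hno (fun i => |d i| ^ q) (fun i => by positivity) (fun i => by
        have h2 := congrFun hz i
        simp only [LV.ff, Pi.zero_apply] at h2
        rw [← LV.mul_psi hq (d i), ← mul_assoc, h2, zero_mul])
      funext i
      have h3 := congrFun h1 i
      simp only [Pi.zero_apply] at h3
      rw [Real.rpow_eq_zero (abs_nonneg _) hq0] at h3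
      exact abs_eq_zero.1 h3)
    have hce : ∀ i, (c i ^ (1 / q)) ^ q = c i := fun i => by
      rw [← Real.rpow_mul (hc i).le, one_div_mul_cancel hq0, Real.rpow_one]
    obtain ⟨U, P, hU, hP, hU0, hU1⟩ := LV.limit (LV.ff q B) (LV.ff_cont hq B)
      (LV.small_sol hn hq B hsym b hb hBb κ hκ hBκ κ1 hκ1 hBκ1 (fun i => c i ^ (1 / q))
        (fun i => Real.rpow_pos_of_pos (hc i) _) (by simp only [hce]; exact hcneg))
    have hUc : ∀ i, Continuous (U i) := fun i =>
      continuous_iff_continuousAt.2 fun x => (hU i x).continuousAt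
    set i0 : Fin N := ⟨0, hN1⟩ with hi0
    refine ⟨fun i x => U i (x i0), fun i => ?_, fun i x => hU0 i _, fun i x => ?_, ?_⟩
    · refine (LV.contDiff_two (U i) (P i) _ (hU i) (hP i) ?_).comp (contDiff_apply ℝ ℝ i0)
      exact ((continuous_apply i).comp ((LV.ff_cont hq B).comp (continuous_pi fun j => hUc j))).neg
    · rw [LV.laplacian_coord i0 (U i) (P i) _ (hU i) (hP i), neg_neg]
      unfold LV.ff
      rw [LV.psi_of_nonneg hq (hU0 i _), sum_mul]
      refine sum_congr rfl fun j _ => ?_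
      rw [abs_of_nonneg (hU0 j _)]
    · by_contra hcon
      push Not at hcon
      have : ∀ i, U i 0 = 0 := fun i => by
        have := congrFun (hcon i) 0
        simpa using this
      simp only [this, sum_const_zero] at hU1
      linarith
  · push Not at hno
    obtain ⟨c, hc, hc0, hne⟩ := hno
    refine ⟨fun i _ => c i ^ (1 / q), fun i => contDiff_const, fun i x => Real.rpow_nonneg (hc i) _,
      fun i x => ?_, ?_⟩
    · have h1 : laplacian (fun _ : Fin N → ℝ => c i ^ (1 / q)) x = 0 := by
        simp [laplacian]
      have hce : ∀ i, (c i ^ (1 / q)) ^ q = c i := fun i => by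
        rw [← Real.rpow_mul (hc i), one_div_mul_cancel hq0, Real.rpow_one]
      rw [h1, neg_zero]
      simp only [hce]
      rw [← sum_mul]
      rcases mul_eq_zero.1 (hc0 i) with h | h
      · rw [h, zero_mul]
      · rw [h, Real.zero_rpow (one_div_ne_zero hq0), Real.zero_rpow (by linarith), mul_zero]
    · obtain ⟨i, hi⟩ := Function.ne_iff.1 hne
      refine ⟨i, fun h => hi ?_⟩
      have := congrFun h 0
      simp only [Pi.zero_apply] at this
      rw [Real.rpow_eq_zero (hc i) (one_div_ne_zero hq0)] at this
      simpa using this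
end

section
/- Let N ≥ 1 and let p satisfy 2 < p ≤ (2N−2)/(N−2) if N ≥ 3 and 2 < p < ∞ if N ≤ 2. Let B = (β_ij) be a symmetric n×n real matrix which is strictly (p−1)-copositive. Then the system −Δu_i = ∑_{j=1}^n β_ij u_j^{p/2} u_i^{p/2−1} (i = 1,…,n) does not admit a nontrivial solution on ℝ^N: if u₁,…,uₙ : ℝ^N → ℝ are C², nonnegative, and satisfy the system on ℝ^N, then u_i ≡ 0 for all i. -/
open Finset

open MeasureTheory Filter Topology

lemma aux_c1 {N : ℕ} {f : (Fin N → ℝ) → ℝ} (hf : ContDiff ℝ 2 f) (v : Fin N → ℝ) :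
    ContDiff ℝ 1 (fun y => fderiv ℝ f y v) :=
  (hf.fderiv_right (m := 1) (by norm_num)).clm_apply contDiff_const

lemma aux_c0 {N : ℕ} {f : (Fin N → ℝ) → ℝ} (hf : ContDiff ℝ 1 f) (v : Fin N → ℝ) :
    Continuous (fun y => fderiv ℝ f y v) :=
  (hf.continuous_fderiv one_ne_zero).clm_apply continuous_const

lemma aux_lap_cont {N : ℕ} {f : (Fin N → ℝ) → ℝ} (hf : ContDiff ℝ 2 f) :
    Continuous (laplacian f) := by
  unfold laplacian
  exact continuous_finsetSum _ fun i _ => aux_c0 (aux_c1 hf _) _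

lemma aux_lap_supp {N : ℕ} {f : (Fin N → ℝ) → ℝ} (hf : HasCompactSupport f) :
    HasCompactSupport (laplacian f) := by
  refine hf.mono' ?_
  intro x hx
  by_contra h
  apply hx
  have h0 : ∀ v : Fin N → ℝ, x ∉ tsupport (fun y => fderiv ℝ f y v) := fun v hv =>
    h (tsupport_fderiv_apply_subset ℝ v hv)
  unfold laplacian
  refine Finset.sum_eq_zero fun i _ => ?_
  have := fun hv => h0 (Pi.single i 1) (tsupport_fderiv_apply_subset ℝ (Pi.single i 1) hv)
  exact image_eq_zero_of_notMem_tsupport (f := fun x => fderiv ℝ (fun y => fderiv ℝ f y (Pi.single i 1)) x (Pi.single i 1)) this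

lemma aux_ibp {N : ℕ} {w f : (Fin N → ℝ) → ℝ} (hw : ContDiff ℝ 2 w) (hf : ContDiff ℝ 2 f)
    (hs : HasCompactSupport f) :
    ∫ x, f x * laplacian w x = ∫ x, w x * laplacian f x := by
  have d1 : ∀ {g : (Fin N → ℝ) → ℝ}, ContDiff ℝ 2 g → Differentiable ℝ g := fun h =>
    h.differentiable (by norm_num)
  have d2 : ∀ {g : (Fin N → ℝ) → ℝ}, ContDiff ℝ 2 g → ∀ v, Differentiable ℝ (fun y => fderiv ℝ g y v) := fun h v =>
    (aux_c1 h v).differentiable (by norm_num)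
  have c0 := fun v => (aux_c1 hf v).continuous
  have c0w := fun v => (aux_c1 hw v).continuous
  have c2 := fun v => aux_c0 (aux_c1 hf v) v
  have c2w := fun v => aux_c0 (aux_c1 hw v) v
  have i1 : ∀ v, Integrable (fun x => f x * fderiv ℝ (fun y => fderiv ℝ w y v) x v) := fun v =>
    (hf.continuous.mul (c2w v)).integrable_of_hasCompactSupport hs.mul_right
  have i2 : ∀ v, Integrable (fun x => fderiv ℝ f x v * fderiv ℝ w x v) := fun v =>
    ((c0 v).mul (c0w v)).integrable_of_hasCompactSupport (hs.fderiv_apply (𝕜 := ℝ) v).mul_right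
  have i3 : ∀ v, Integrable (fun x => fderiv ℝ (fun y => fderiv ℝ f y v) x v * w x) := fun v =>
    ((c2 v).mul hw.continuous).integrable_of_hasCompactSupport 
      ((hs.fderiv_apply (𝕜 := ℝ) v).fderiv_apply (𝕜 := ℝ) v).mul_right
  have i4 : ∀ v, Integrable (fun x => fderiv ℝ f x v * w x) := fun v =>
    ((c0 v).mul hw.continuous).integrable_of_hasCompactSupport (hs.fderiv_apply (𝕜 := ℝ) v).mul_right
  have i5 : ∀ v, Integrable (fun x => f x * fderiv ℝ w x v) := fun v =>
    (hf.continuous.mul (c0w v)).integrable_of_hasCompactSupport hs.mul_right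
  have key : ∀ v : Fin N → ℝ, ∫ x, f x * fderiv ℝ (fun y => fderiv ℝ w y v) x v
      = ∫ x, fderiv ℝ (fun y => fderiv ℝ f y v) x v * w x := by
    intro v
    rw [integral_mul_fderiv_eq_neg_fderiv_mul_of_integrable (i2 v) (i1 v) (i5 v)
      (fun x _ => d1 hf x) (fun x _ => d2 hw v x),
      integral_mul_fderiv_eq_neg_fderiv_mul_of_integrable (i3 v) (i2 v) (i4 v)
      (fun x _ => d2 hf v x) (fun x _ => d1 hw x), neg_neg]
  unfold laplacian
  simp_rw [Finset.mul_sum]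
  rw [integral_finsetSum _ fun i _ => i1 _, integral_finsetSum _ fun i _ => ?_]
  · refine Finset.sum_congr rfl fun i _ => ?_
    rw [key]
    simp_rw [mul_comm]
  · simpa [mul_comm] using i3 (Pi.single i 1)

lemma aux_lap_scale {N : ℕ} (f : (Fin N → ℝ) → ℝ) (r : ℝ) (x : Fin N → ℝ)
    (hf : ContDiff ℝ 2 f) :
    laplacian (fun y => f (r • y)) x = r ^ 2 * laplacian f (r • x) := by
  unfold laplacian
  rw [Finset.mul_sum]
  refine Finset.sum_congr rfl fun i _ => ?_
  have h1 : (fun y => fderiv ℝ (fun y => f (r • y)) y (Pi.single i 1)) =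
      fun y => r * (fun z => fderiv ℝ f z (Pi.single i 1)) (r • y) := by
    ext y
    rw [fderiv_comp_smul]; simp
  rw [h1, fderiv_const_mul, fderiv_comp_smul (f := fun z => fderiv ℝ f z (Pi.single i 1))]
  · simp; ring
  · have := (aux_c1 hf (Pi.single i 1)).differentiable one_ne_zero
    exact (this.comp (by fun_prop : Differentiable ℝ fun y : Fin N → ℝ => r • y)) x

lemma aux_lap_sum {N n : ℕ} (u : Fin n → (Fin N → ℝ) → ℝ) (m : Fin n → ℝ)
    (hu : ∀ i, ContDiff ℝ 2 (u i)) (x : Fin N → ℝ) :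
    laplacian (fun y => ∑ i, m i * u i y) x = ∑ i, m i * laplacian (u i) x := by
  unfold laplacian
  simp_rw [Finset.mul_sum]
  rw [Finset.sum_comm]
  refine Finset.sum_congr rfl fun k _ => ?_
  have h1 : (fun y => fderiv ℝ (fun y => ∑ i, m i * u i y) y (Pi.single k 1)) =
      fun y => ∑ i, m i * fderiv ℝ (u i) y (Pi.single k 1) := by
    ext y
    have hd : ∀ i, DifferentiableAt ℝ (u i) y := fun i => (hu i).differentiable (by norm_num) y
    rw [fderiv_fun_sum fun i _ => (hd i).const_mul _]
    simp only [_root_.sum_apply]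
    refine Finset.sum_congr rfl fun i _ => ?_
    rw [fderiv_const_mul (hd i)]; simp
  have hd : ∀ i, DifferentiableAt ℝ (fun y => fderiv ℝ (u i) y (Pi.single k 1)) x :=
    fun i => (aux_c1 (hu i) _).differentiable (by norm_num) x
  rw [h1, fderiv_fun_sum fun i _ => (hd i).const_mul _]
  simp only [_root_.sum_apply]
  refine Finset.sum_congr rfl fun i _ => ?_
  rw [fderiv_const_mul (hd i)]; simp

lemma aux_lap_pow {N : ℕ} (f : (Fin N → ℝ) → ℝ) (k : ℕ) (x : Fin N → ℝ)
    (hf : ContDiff ℝ 2 f) :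
    laplacian (fun y => f y ^ (k + 2)) x = f x ^ k *
      ((k + 2) * (k + 1) * ∑ i, (fderiv ℝ f x (Pi.single i 1)) ^ 2 + (k + 2) * f x * laplacian f x) := by
  unfold laplacian
  rw [Finset.mul_sum, Finset.mul_sum, ← Finset.sum_add_distrib, Finset.mul_sum]
  refine Finset.sum_congr rfl fun i _ => ?_
  have hd : Differentiable ℝ f := hf.differentiable (by norm_num)
  have h1 : (fun y => fderiv ℝ (fun y => f y ^ (k + 2)) y (Pi.single i 1)) =
      fun y => (k + 2) * f y ^ (k + 1) * fderiv ℝ f y (Pi.single i 1) := by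
    ext y
    rw [((hd y).hasFDerivAt.pow (k + 2)).fderiv]
    simp
  have h2 := (aux_c1 hf (Pi.single i 1)).differentiable one_ne_zero x
  have h3 : HasFDerivAt (fun y => ((k : ℝ) + 2) * f y ^ (k + 1) * fderiv ℝ f y (Pi.single i 1)) _ x :=
    (((hd x).hasFDerivAt.pow (k + 1)).const_mul ((k : ℝ) + 2)).mul h2.hasFDerivAt
  rw [h1, h3.fderiv]
  simp
  ring

lemma aux_test (N : ℕ) (q : ℝ) (hq : 1 < q) : ∃ (f : (Fin N → ℝ) → ℝ) (C : ℝ), 0 < C ∧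
    ContDiff ℝ 2 f ∧ HasCompactSupport f ∧ (∀ x, 0 ≤ f x) ∧ (∀ x, f x ≤ 1) ∧ (∀ x, ‖x‖ < 1 → f x = 1) ∧
    (∀ x, 2 ≤ ‖x‖ → f x = 0) ∧ (∀ x, ‖x‖ < 1 → laplacian f x = 0) ∧
    (∀ x, |laplacian f x| ≤ C * f x ^ (1 / q)) := by
  let b : ContDiffBump (0 : Fin N → ℝ) := ⟨1, 2, by norm_num, by norm_num⟩
  obtain ⟨k, hk⟩ := exists_nat_ge (2 / (q - 1) + 1)
  have hb : ContDiff ℝ 2 b := b.contDiff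
  have hG : Continuous fun x => ((k + 2) * (k + 1) * ∑ i, (fderiv ℝ b x (Pi.single i 1)) ^ 2 + (k + 2) * b x * laplacian b x : ℝ) := by
    have := fun v => (aux_c1 hb v).continuous
    have := aux_lap_cont hb
    have := b.continuous
    fun_prop
  have hl := aux_lap_pow b k
  have hcs : HasCompactSupport fun x => b x ^ (k + 2) := by
    have := b.hasCompactSupport
    exact this.comp_left (g := fun t : ℝ => t ^ (k + 2)) (by simp)
  obtain ⟨C, hC⟩ := (isCompact_closedBall (0 : Fin N → ℝ) 2).exists_bound_of_continuousOn hG.continuousOn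
  refine ⟨fun x => b x ^ (k + 2), |C| + 1, by positivity, hb.pow _, hcs, fun x => pow_nonneg b.nonneg _,
    fun x => pow_le_one₀ b.nonneg b.le_one,
    ?_, ?_, ?_, ?_⟩
  · intro x hx
    simp [b.one_of_mem_closedBall (x := x) (by simpa [b] using hx.le)]
  · intro x hx
    simp [b.zero_of_le_dist (x := x) (by simpa [b] using hx)]
  · intro x hx
    rw [hl x hb]
    have he : b =ᶠ[𝓝 x] 1 := b.eventuallyEq_one_of_mem_ball (by simpa [b] using hx)
    have h1 : fderiv ℝ b x = 0 := by
      rw [he.fderiv_eq]; simp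
    have h2 : laplacian b x = 0 := by
      unfold laplacian
      refine Finset.sum_eq_zero fun i _ => ?_
      have : (fun y => fderiv ℝ b y (Pi.single i 1)) =ᶠ[𝓝 x] fun _ => (0 : ℝ) := by
        filter_upwards [he.fderiv (𝕜 := ℝ)] with y hy
        rw [hy]; simp
      rw [this.fderiv_eq]; simp
    simp [h1, h2]
  · intro x
    have hkpos : 0 < k := by
      have : (0 : ℝ) < k := by
        have : 0 < 2 / (q - 1) := div_pos two_pos (by linarith)
        linarith
      exact_mod_cast this
    rcases le_or_gt 2 ‖x‖ with hx | hx
    · have h0 := b.zero_of_le_dist (x := x) (by simpa [b] using hx)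
      rw [hl x hb, h0]
      simp [hkpos.ne']
      positivity
    · rw [hl x hb, abs_mul, mul_comm]
      have h0 : 0 ≤ b x := b.nonneg
      refine mul_le_mul ?_ ?_ (by positivity) (by positivity)
      · have := hC x (by simpa using hx.le)
        rw [Real.norm_eq_abs] at this
        exact this.trans ((le_abs_self C).trans (by linarith))
      · rw [abs_of_nonneg (pow_nonneg h0 _)]
        beta_reduce
        rw [← Real.rpow_natCast, ← Real.rpow_natCast, ← Real.rpow_mul h0]
        have hpos : 0 < b x := b.pos_of_mem_ball (by simpa [b] using hx)
        apply Real.rpow_le_rpow_of_exponent_ge hpos b.le_one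
        push_cast
        rw [mul_one_div, div_le_iff₀ (by linarith)]
        have h3 : 2 / (q - 1) ≤ k := by linarith
        rw [div_le_iff₀ (by linarith)] at h3
        linarith

lemma aux_young {q d s : ℝ} (hq : 1 < q) (hd : 0 < d) (hs : 0 ≤ s) :
    s ≤ d ^ (1 - q) * s ^ q + d := by
  rcases le_or_gt s d with h | h
  · have : 0 ≤ d ^ (1 - q) * s ^ q := by positivity
    linarith
  · have hs' : 0 < s := hd.trans h
    have h1 : s ^ q = s ^ (q - 1) * s := by
      rw [← Real.rpow_add_one hs'.ne']; simp
    have h2 : d ^ (1 - q) * d ^ (q - 1) = 1 := by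
      rw [← Real.rpow_add hd]; simp
    have h3 : d ^ (q - 1) ≤ s ^ (q - 1) := Real.rpow_le_rpow hd.le h.le (by linarith)
    have h4 : 1 ≤ d ^ (1 - q) * s ^ (q - 1) := by
      have := mul_le_mul_of_nonneg_left h3 (Real.rpow_nonneg hd.le (1 - q))
      rwa [h2] at this
    rw [h1, ← mul_assoc]
    nlinarith

lemma aux_young2 {q d w t R : ℝ} (N : ℕ) (hq : 1 < q) (hN : N * (q - 1) ≤ 2 * q) (hd : 0 < d)
    (hw : 0 ≤ w) (ht : 0 ≤ t) (hR : 1 ≤ R) :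
    (R⁻¹) ^ 2 * (w * t ^ (1 / q)) ≤ d ^ (1 - q) * (t * w ^ q) + d * (R ^ N)⁻¹ := by
  have hR0 : 0 < R := by linarith
  set E := R ^ (2 / (q - 1)) with hE
  have hE0 : 0 < E := by positivity
  have hq1 : 0 < q - 1 := by linarith
  have h1 : E ^ q = R ^ 2 * E := by
    rw [hE, ← Real.rpow_mul hR0.le, ← Real.rpow_natCast, ← Real.rpow_add hR0]
    congr 1
    push_cast
    field_simp
    ring
  have h2 : R ^ N ≤ E ^ q := by
    rw [hE, ← Real.rpow_mul hR0.le, ← Real.rpow_natCast]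
    apply Real.rpow_le_rpow_of_exponent_le hR
    rw [div_mul_eq_mul_div, le_div_iff₀ hq1]
    exact hN
  have h3 := aux_young hq hd (s := w * t ^ (1 / q) * E) (by positivity)
  have h4 : (w * t ^ (1 / q) * E) ^ q = t * w ^ q * E ^ q := by
    rw [Real.mul_rpow (by positivity) hE0.le, Real.mul_rpow hw (by positivity),
      ← Real.rpow_mul ht]
    rw [one_div_mul_cancel (by linarith), Real.rpow_one]; ring
  rw [h4] at h3
  have h5 : 0 < E ^ q := by positivity
  have h6 : (R⁻¹) ^ 2 * (w * t ^ (1 / q)) = (w * t ^ (1 / q) * E) / E ^ q := by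
    rw [h1]; field_simp
  have h7 : (w * t ^ (1 / q) * E) / E ^ q ≤ d ^ (1 - q) * (t * w ^ q) + d * (E ^ q)⁻¹ := by
    rw [div_le_iff₀ h5]
    refine h3.trans (le_of_eq ?_)
    field_simp
  rw [h6]
  refine h7.trans ?_
  gcongr

lemma aux_liouville {N : ℕ} {q κ : ℝ} (hq : 1 < q) (hN : N * (q - 1) ≤ 2 * q) (hκ : 0 < κ)
    {w : (Fin N → ℝ) → ℝ} (hw : ContDiff ℝ 2 w) (hw0 : ∀ x, 0 ≤ w x)
    (hlap : ∀ x, κ * w x ^ q ≤ -laplacian w x) : w = 0 := by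
  obtain ⟨f, C, hC, hf, hfs, hf0, hfle, hf1, hf2, hfl, hfb⟩ := aux_test N q hq
  set K := (volume : Measure (Fin N → ℝ)).real (Metric.ball 0 2) with hK
  have hK0 : 0 ≤ K := measureReal_nonneg
  have hwq : Continuous fun x => w x ^ q := hw.continuous.rpow_const fun x => Or.inr (by linarith)
  have hwq0 : ∀ x, 0 ≤ w x ^ q := fun x => Real.rpow_nonneg (hw0 x) _
  have hsm : ∀ R : ℝ, ContDiff ℝ 2 (fun x => f (R⁻¹ • x)) := fun R =>
    hf.comp (contDiff_const_smul _)
  have hsc : ∀ R : ℝ, 1 ≤ R → HasCompactSupport (fun x => f (R⁻¹ • x)) := fun R hR =>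
    hfs.comp_smul (inv_ne_zero (by linarith))
  have hint : ∀ R : ℝ, 1 ≤ R → Integrable (fun x => f (R⁻¹ • x) * w x ^ q) := fun R hR =>
    ((hsm R).continuous.mul hwq).integrable_of_hasCompactSupport (hsc R hR).mul_right
  have hnorm : ∀ R : ℝ, 1 ≤ R → ∀ x : Fin N → ℝ, ‖R⁻¹ • x‖ = ‖x‖ / R := fun R hR x => by
    rw [norm_smul, norm_inv, Real.norm_of_nonneg (by linarith), inv_mul_eq_div]
  have main : ∀ R : ℝ, 1 ≤ R → ∀ d : ℝ, 0 < d → κ * ∫ x, f (R⁻¹ • x) * w x ^ q ≤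
      C * (d ^ (1 - q) * (∫ x in (Metric.ball 0 R)ᶜ, f (R⁻¹ • x) * w x ^ q) + d * K) := by
    intro R hR d hd
    have hR0 : 0 < R := by linarith
    have hib := aux_ibp hw (hsm R) (hsc R hR)
    have hi1 : Integrable fun x => f (R⁻¹ • x) * laplacian w x :=
      ((hsm R).continuous.mul (aux_lap_cont hw)).integrable_of_hasCompactSupport
        (hsc R hR).mul_right
    have hi2 : Integrable fun x => w x * laplacian (fun x => f (R⁻¹ • x)) x :=
      (hw.continuous.mul (aux_lap_cont (hsm R))).integrable_of_hasCompactSupport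
        (aux_lap_supp (hsc R hR)).mul_left
    have s1 : κ * ∫ x, f (R⁻¹ • x) * w x ^ q ≤ ∫ x, -(f (R⁻¹ • x) * laplacian w x) := by
      rw [← integral_const_mul]
      refine integral_mono ((hint R hR).const_mul κ) hi1.neg fun x => ?_
      have := mul_le_mul_of_nonneg_left (hlap x) (hf0 (R⁻¹ • x))
      simp only
      linarith
    have hmb : MeasurableSet (Metric.ball (0 : Fin N → ℝ) R)ᶜ := measurableSet_ball.compl
    have hg1 : Integrable ((Metric.ball (0 : Fin N → ℝ) R)ᶜ.indicator
        fun x => f (R⁻¹ • x) * w x ^ q) := (hint R hR).indicator hmb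
    have hg2 : Integrable ((Metric.ball (0 : Fin N → ℝ) (R * 2)).indicator
        fun _ => (R ^ N)⁻¹) := by
      rw [integrable_indicator_iff measurableSet_ball]
      exact integrableOn_const (by exact measure_ball_lt_top.ne)
    have s2 : ∫ x, -(w x * laplacian (fun x => f (R⁻¹ • x)) x) ≤
        ∫ x, C * (d ^ (1 - q) * (Metric.ball (0 : Fin N → ℝ) R)ᶜ.indicator
          (fun x => f (R⁻¹ • x) * w x ^ q) x + d * (Metric.ball (0 : Fin N → ℝ) (R * 2)).indicator
        (fun _ => (R ^ N)⁻¹) x) := by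
      refine integral_mono hi2.neg (((hg1.const_mul _).add (hg2.const_mul _)).const_mul _) fun x => ?_
      simp only
      rw [aux_lap_scale _ _ _ hf]
      have hnn : 0 ≤ C * (d ^ (1 - q) * (Metric.ball (0 : Fin N → ℝ) R)ᶜ.indicator
          (fun x => f (R⁻¹ • x) * w x ^ q) x + d * (Metric.ball (0 : Fin N → ℝ) (R * 2)).indicator
        (fun _ => (R ^ N)⁻¹) x) := by
        have a1 : 0 ≤ (Metric.ball (0 : Fin N → ℝ) R)ᶜ.indicator
          (fun x => f (R⁻¹ • x) * w x ^ q) x :=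
          Set.indicator_nonneg (fun y _ => mul_nonneg (hf0 _) (hwq0 _)) _
        have a2 : 0 ≤ (Metric.ball (0 : Fin N → ℝ) (R * 2)).indicator (fun _ => (R ^ N)⁻¹) x :=
          Set.indicator_nonneg (fun y _ => by positivity) _
        positivity
      rcases lt_or_ge ‖x‖ R with h | h
      · rw [hfl _ (by rw [hnorm R hR, div_lt_one hR0]; exact h)]
        simpa using hnn
      rcases le_or_gt (R * 2) ‖x‖ with h' | h'
      · have e0 := hf2 (R⁻¹ • x) (by rw [hnorm R hR, le_div_iff₀ hR0]; linarith)
        have e1 := hfb (R⁻¹ • x)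
        rw [e0, Real.zero_rpow (by positivity), mul_zero, abs_nonpos_iff] at e1
        rw [e1]
        simpa using hnn
      · rw [Set.indicator_of_mem (by simpa using h), Set.indicator_of_mem (by simpa using h')]
        have e1 := aux_young2 N hq hN hd (hw0 x) (hf0 (R⁻¹ • x)) hR
        have e2 : -laplacian f (R⁻¹ • x) ≤ C * f (R⁻¹ • x) ^ (1 / q) :=
          (neg_le_abs _).trans (hfb _)
        calc -(w x * (R⁻¹ ^ 2 * laplacian f (R⁻¹ • x)))
            = (R⁻¹ ^ 2 * w x) * (-laplacian f (R⁻¹ • x)) := by ring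
          _ ≤ (R⁻¹ ^ 2 * w x) * (C * f (R⁻¹ • x) ^ (1 / q)) :=
            mul_le_mul_of_nonneg_left e2 (mul_nonneg (by positivity) (hw0 x))
          _ = C * (R⁻¹ ^ 2 * (w x * f (R⁻¹ • x) ^ (1 / q))) := by ring
          _ ≤ _ := mul_le_mul_of_nonneg_left e1 hC.le
    have hvol : (volume : Measure (Fin N → ℝ)).real (Metric.ball 0 (R * 2)) = R ^ N * K := by
      rw [hK, measureReal_def, Measure.addHaar_ball_mul_of_pos _ _ hR0, ENNReal.toReal_mul,
        ENNReal.toReal_ofReal (by positivity), measureReal_def]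
      simp
    rw [integral_const_mul, integral_add (hg1.const_mul _) (hg2.const_mul _), integral_const_mul,
      integral_const_mul, integral_indicator hmb, integral_indicator measurableSet_ball,
      setIntegral_const, hvol] at s2
    have e3 : (R ^ N * K) • (R ^ N)⁻¹ = K := by
      rw [smul_eq_mul]; field_simp
    rw [e3] at s2
    rw [integral_neg] at s1 s2
    rw [hib] at s1
    exact s1.trans s2
  have hle : ∀ R : ℝ, 1 ≤ R → ∫ x in Metric.ball 0 R, w x ^ q ≤ ∫ x, f (R⁻¹ • x) * w x ^ q := by
    intro R hR
    have hR0 : 0 < R := by linarith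
    rw [show ∫ x in Metric.ball 0 R, w x ^ q = ∫ x in Metric.ball 0 R, f (R⁻¹ • x) * w x ^ q from ?_]
    · exact setIntegral_le_integral (hint R hR) (Eventually.of_forall fun x => mul_nonneg (hf0 _) (hwq0 x))
    · refine setIntegral_congr_fun measurableSet_ball fun x hx => ?_
      have hx' : ‖x‖ < R := by simpa using hx
      rw [hf1 _ (by rw [hnorm R hR, div_lt_one hR0]; exact hx'), one_mul]
  have hcov : AECover (volume : Measure (Fin N → ℝ)) atTop (fun R : ℝ => Metric.ball 0 R) :=
    aecover_ball tendsto_id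
  have hion : ∀ R : ℝ, IntegrableOn (fun x => w x ^ q) (Metric.ball 0 R) := fun R =>
    (hwq.continuousOn.integrableOn_compact (isCompact_closedBall 0 R)).mono_set Metric.ball_subset_closedBall
  have hI : Integrable fun x => w x ^ q := by
    obtain ⟨d, hd, hdq⟩ : ∃ d : ℝ, 0 < d ∧ C * d ^ (1 - q) = κ / 2 := by
      refine ⟨(κ / 2 / C) ^ (1 / (1 - q)), by positivity, ?_⟩
      rw [← Real.rpow_mul (by positivity), one_div_mul_cancel (by linarith), Real.rpow_one]
      field_simp
    refine hcov.integrable_of_integral_bounded_of_nonneg_ae (2 * (C * (d * K)) / κ) hion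
      (Eventually.of_forall hwq0) ?_
    filter_upwards [eventually_ge_atTop 1] with R hR
    refine (hle R hR).trans ?_
    have m := main R hR d hd
    have e : ∫ x in (Metric.ball 0 R)ᶜ, f (R⁻¹ • x) * w x ^ q ≤ ∫ x, f (R⁻¹ • x) * w x ^ q :=
      setIntegral_le_integral (hint R hR) (Eventually.of_forall fun x => mul_nonneg (hf0 _) (hwq0 x))
    have e' := mul_le_mul_of_nonneg_left e (by positivity : 0 ≤ κ / 2)
    rw [mul_add, ← mul_assoc, hdq] at m
    rw [le_div_iff₀ hκ]
    linarith
  have ht := hcov.integral_tendsto_of_countably_generated hI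
  set T := ∫ x, w x ^ q with hT
  have hTd : ∀ d : ℝ, 0 < d → κ * T ≤ C * (d * K) := by
    intro d hd
    have t1 : Tendsto (fun R : ℝ => C * (d ^ (1 - q) * (T - ∫ x in Metric.ball 0 R, w x ^ q) + d * K))
        atTop (𝓝 (C * (d ^ (1 - q) * (T - T) + d * K))) :=
      (((ht.const_sub T).const_mul _).add_const _).const_mul _
    rw [sub_self, mul_zero, zero_add] at t1
    refine le_of_tendsto_of_tendsto (ht.const_mul κ) t1 ?_
    filter_upwards [eventually_ge_atTop 1] with R hR
    have e1 : ∫ x in (Metric.ball 0 R)ᶜ, f (R⁻¹ • x) * w x ^ q ≤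
        ∫ x in (Metric.ball 0 R)ᶜ, w x ^ q :=
      integral_mono (hint R hR).integrableOn hI.integrableOn fun x =>
        mul_le_of_le_one_left (hwq0 x) (hfle _)
    have e2 : ∫ x in (Metric.ball 0 R)ᶜ, w x ^ q = T - ∫ x in Metric.ball 0 R, w x ^ q := by
      rw [hT, ← integral_add_compl (measurableSet_ball (x := (0 : Fin N → ℝ)) (ε := R)) hI]; ring
    rw [e2] at e1
    calc κ * ∫ x in Metric.ball 0 R, w x ^ q ≤ κ * ∫ x, f (R⁻¹ • x) * w x ^ q :=
          mul_le_mul_of_nonneg_left (hle R hR) hκ.le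
      _ ≤ _ := main R hR d hd
      _ ≤ _ := by
        have := mul_le_mul_of_nonneg_left e1 (Real.rpow_nonneg hd.le (1 - q))
        exact mul_le_mul_of_nonneg_left (by linarith) hC.le
  have hT0 : T = 0 := by
    apply le_antisymm _ (integral_nonneg hwq0)
    by_contra! hpos
    have h := hTd (κ * T / (2 * C * (K + 1))) (by positivity)
    have h2 : C * (κ * T / (2 * C * (K + 1)) * K) = κ * T * (K / (2 * (K + 1))) := by
      field_simp
    have h3 : K / (2 * (K + 1)) < 1 := by
      rw [div_lt_one (by positivity)]; linarith
    rw [h2] at h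
    have : 0 < κ * T := by positivity
    nlinarith
  rw [hT, integral_eq_zero_iff_of_nonneg hwq0 hI] at hT0
  have h0 : (fun x => w x ^ q) = fun _ => 0 :=
    (Continuous.ae_eq_iff_eq volume hwq continuous_const).1 hT0
  ext x
  have := congrFun h0 x
  exact (Real.rpow_eq_zero (hw0 x) (by linarith)).1 this

lemma aux_copos {n : ℕ} {p : ℝ} (hp : 2 < p) (B : Matrix (Fin n) (Fin n) ℝ) (μ : Fin n → ℝ)
    (hμ : ∀ i, 0 ≤ μ i)
    (h : ∀ c : Fin n → ℝ, (∀ i, 0 ≤ c i) → c ≠ 0 →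
      0 < ∑ i, ∑ j, B i j * c j ^ (p / 2) * c i ^ (p / 2 - 1) * μ i) :
    ∃ κ > 0, ∀ c : Fin n → ℝ, (∀ i, 0 ≤ c i) →
      κ * (∑ i, μ i * c i) ^ (p - 1) ≤
        ∑ i, ∑ j, B i j * c j ^ (p / 2) * c i ^ (p / 2 - 1) * μ i := by
  set F : (Fin n → ℝ) → ℝ := fun c => ∑ i, ∑ j, B i j * c j ^ (p / 2) * c i ^ (p / 2 - 1) * μ i
    with hF
  have hFc : Continuous F := by
    have h1 : ∀ j, Continuous fun c : Fin n → ℝ => c j ^ (p / 2) := fun j =>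
      (continuous_apply j).rpow_const fun x => Or.inr (by linarith)
    have h2 : ∀ j, Continuous fun c : Fin n → ℝ => c j ^ (p / 2 - 1) := fun j =>
      (continuous_apply j).rpow_const fun x => Or.inr (by linarith)
    fun_prop
  have hhom : ∀ (t : ℝ) (c : Fin n → ℝ), 0 < t → (∀ i, 0 ≤ c i) →
      F (fun i => t * c i) = t ^ (p - 1) * F c := by
    intro t c ht hc
    simp only [hF, Finset.mul_sum]
    refine Finset.sum_congr rfl fun i _ => Finset.sum_congr rfl fun j _ => ?_
    rw [Real.mul_rpow ht.le (hc j), Real.mul_rpow ht.le (hc i),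
      show p - 1 = p / 2 + (p / 2 - 1) by ring, Real.rpow_add ht]
    ring
  have hc := isCompact_stdSimplex ℝ (Fin n)
  set S := ∑ i, μ i + 1 with hS
  have hSμ : ∀ i, μ i ≤ S := fun i => by
    have := Finset.single_le_sum (fun i _ => hμ i) (Finset.mem_univ i)
    linarith
  have hS0 : 0 < S := by
    have : 0 ≤ ∑ i, μ i := Finset.sum_nonneg fun i _ => hμ i
    linarith
  obtain ⟨k, hk, hkF⟩ : ∃ k > 0, ∀ c ∈ stdSimplex ℝ (Fin n), k ≤ F c := by
    rcases (stdSimplex ℝ (Fin n)).eq_empty_or_nonempty with he | hne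
    · exact ⟨1, one_pos, by simp [he]⟩
    · obtain ⟨c0, hc0, hmin⟩ := hc.exists_isMinOn hne hFc.continuousOn
      refine ⟨F c0, h c0 hc0.1 ?_, fun c hc => hmin hc⟩
      rintro rfl
      simpa using hc0.2
  refine ⟨k * (S ^ (p - 1))⁻¹, by positivity, fun c hc => ?_⟩
  by_cases hc0 : c = 0
  · subst hc0
    have : p - 1 ≠ 0 := by linarith
    have h' : p / 2 ≠ 0 := by linarith
    simp [Real.zero_rpow this, Real.zero_rpow h']
  set t := ∑ i, c i with htdef
  have ht : 0 < t := by
    obtain ⟨i, hi⟩ := Function.ne_iff.1 hc0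
    exact Finset.sum_pos' (fun i _ => hc i) ⟨i, Finset.mem_univ i, lt_of_le_of_ne (hc i) (Ne.symm hi)⟩
  have hmem : (fun i => t⁻¹ * c i) ∈ stdSimplex ℝ (Fin n) := by
    refine ⟨fun i => mul_nonneg (by positivity) (hc i), ?_⟩
    rw [← Finset.mul_sum, ← htdef, inv_mul_cancel₀ ht.ne']
  have e1 := hkF _ hmem
  rw [hhom _ _ (by positivity) hc, Real.inv_rpow ht.le, inv_mul_eq_div,
    le_div_iff₀ (by positivity)] at e1
  have e2 : (∑ i, μ i * c i) ^ (p - 1) ≤ S ^ (p - 1) * t ^ (p - 1) := by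
    rw [← Real.mul_rpow hS0.le ht.le]
    apply Real.rpow_le_rpow (Finset.sum_nonneg fun i _ => mul_nonneg (hμ i) (hc i)) _ (by linarith)
    rw [htdef, Finset.mul_sum]
    exact Finset.sum_le_sum fun i _ => mul_le_mul_of_nonneg_right (hSμ i) (hc i)
  calc k * (S ^ (p - 1))⁻¹ * (∑ i, μ i * c i) ^ (p - 1)
      ≤ k * (S ^ (p - 1))⁻¹ * (S ^ (p - 1) * t ^ (p - 1)) := by gcongr
    _ = k * t ^ (p - 1) := by field_simp
    _ ≤ F c := e1

theorem stmt_9 (N n : ℕ) (hN1 : 1 ≤ N) (p : ℝ) (hp : 2 < p)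
    (hpN : 3 ≤ N → p ≤ (2 * N - 2) / (N - 2))
    (B : Matrix (Fin n) (Fin n) ℝ) (hsym : B.IsSymm)
    (hscc : (∃ μ : Fin n → ℝ, (∀ i, 0 ≤ μ i) ∧ ∀ c : Fin n → ℝ, (∀ i, 0 ≤ c i) → c ≠ 0 → 0 < ∑ i, ∑ j, B i j * c j ^ (p / 2) * c i ^ (p / 2 - 1) * μ i))
    (u : Fin n → (Fin N → ℝ) → ℝ)
    (hreg : ∀ i, ContDiff ℝ 2 (u i))
    (hpos : ∀ i x, 0 ≤ u i x)
    (heq : ∀ i x, -laplacian (u i) x =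
      ∑ j, B i j * (u j x) ^ (p / 2) * (u i x) ^ (p / 2 - 1)) :
    ∀ i, u i = 0 := by
  obtain ⟨μ, hμ, hpos'⟩ := hscc
  obtain ⟨κ, hκ, hF⟩ := aux_copos hp B μ hμ hpos'
  have hw : ContDiff ℝ 2 (fun y => ∑ i, μ i * u i y) :=
    ContDiff.sum fun i _ => contDiff_const.mul (hreg i)
  have hl : ∀ x, -laplacian (fun y => ∑ i, μ i * u i y) x =
      ∑ i, ∑ j, B i j * (u j x) ^ (p / 2) * (u i x) ^ (p / 2 - 1) * μ i := by
    intro x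
    rw [aux_lap_sum u μ hreg x, ← Finset.sum_neg_distrib]
    refine Finset.sum_congr rfl fun i _ => ?_
    rw [← mul_neg, heq, mul_comm, Finset.sum_mul]
  have hN : (N : ℝ) * (p - 1 - 1) ≤ 2 * (p - 1) := by
    rcases le_or_gt 3 N with h | h
    · have h3 : (3 : ℝ) ≤ N := by exact_mod_cast h
      have := hpN h
      rw [le_div_iff₀ (by linarith)] at this
      linarith
    · have h2 : (N : ℝ) ≤ 2 := by exact_mod_cast Nat.lt_succ_iff.1 h
      nlinarith
  have h0 := aux_liouville (q := p - 1) (by linarith) hN hκ hw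
    (fun x => Finset.sum_nonneg fun i _ => mul_nonneg (hμ i) (hpos i x))
    (fun x => by rw [hl x]; exact hF (fun i => u i x) fun i => hpos i x)
  intro i
  ext x
  by_contra hne
  have h1 := hpos' (fun i => u i x) (fun i => hpos i x) (fun hc => hne (congrFun hc i))
  have h2 := hl x
  rw [h0] at h2
  have h3 : laplacian (0 : (Fin N → ℝ) → ℝ) x = 0 := by
    simp [laplacian]
  rw [h3] at h2
  linarith
end

section
/- Let p > 2 and let B = (β_ij) be a symmetric n×n real matrix. If B is strictly (p−1)-copositive, then B is strictly copositive. -/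
open Finset

theorem stmt_10 (n : ℕ) (p : ℝ) (hp : 2 < p)
    (B : Matrix (Fin n) (Fin n) ℝ) (hsym : B.IsSymm)
    (hscc : (∃ μ : Fin n → ℝ, (∀ i, 0 ≤ μ i) ∧ ∀ c : Fin n → ℝ, (∀ i, 0 ≤ c i) → c ≠ 0 → 0 < ∑ i, ∑ j, B i j * c j ^ (p / 2) * c i ^ (p / 2 - 1) * μ i)) :
    (∀ c : Fin n → ℝ, (∀ i, 0 ≤ c i) → c ≠ 0 → 0 < ∑ i, ∑ j, B i j * c i * c j) := by
  intro c hc hc0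
  obtain ⟨μ, hμ, H⟩ := hscc
  have hQ : ∀ x : Fin n → ℝ, ∑ i, ∑ j, B i j * x i * x j = x ⬝ᵥ B.mulVec x := by
    intro x
    simp only [dotProduct, Matrix.mulVec, Finset.mul_sum]
    exact Finset.sum_congr rfl fun i _ => Finset.sum_congr rfl fun j _ => by ring
  have hS : 0 < ∑ i, c i := by
    obtain ⟨i, hi⟩ := Function.ne_iff.mp hc0
    exact Finset.sum_pos' (fun i _ => hc i) ⟨i, mem_univ i, lt_of_le_of_ne (hc i) (Ne.symm hi)⟩
  set S := ∑ i, c i with hSdef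
  have hcS : S⁻¹ • c ∈ stdSimplex ℝ (Fin n) := by
    refine ⟨fun i => mul_nonneg (inv_nonneg.mpr hS.le) (hc i), ?_⟩
    simp only [Pi.smul_apply, smul_eq_mul, ← Finset.mul_sum]
    exact inv_mul_cancel₀ hS.ne'
  obtain ⟨x, hx, hmin⟩ := (isCompact_stdSimplex ℝ (Fin n)).exists_isMinOn ⟨_, hcS⟩
    (f := fun x => x ⬝ᵥ B.mulVec x)
    (by
      apply Continuous.continuousOn
      simp only [dotProduct, Matrix.mulVec]
      fun_prop)
  obtain ⟨m, hm⟩ : ∃ m, m = x ⬝ᵥ B.mulVec x := ⟨_, rfl⟩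
  have hmin' : ∀ y ∈ stdSimplex ℝ (Fin n), m ≤ y ⬝ᵥ B.mulVec y := fun y hy => by
    rw [hm]; exact hmin hy
  have hge : ∀ i, m ≤ B.mulVec x i := by
    intro i
    have key : ∀ t : ℝ, 0 < t → t ≤ 1 → 0 ≤ 2 * (B.mulVec x i - m) + t * (m - 2 * B.mulVec x i + B i i) := by
      intro t ht ht1
      have hy := (convex_stdSimplex ℝ (Fin n)) hx (single_mem_stdSimplex ℝ i)
        (sub_nonneg.mpr ht1) ht.le (by ring)
      have h := hmin' _ hy
      have e1 : x ⬝ᵥ B.mulVec (Pi.single i 1) = B.mulVec x i := by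
        rw [Matrix.dotProduct_mulVec, ← Matrix.mulVec_transpose, hsym.eq]; simp
      have e2 : (Pi.single i 1 : Fin n → ℝ) ⬝ᵥ B.mulVec (Pi.single i 1) = B i i := by simp
      have e3 : (Pi.single i 1 : Fin n → ℝ) ⬝ᵥ B.mulVec x = B.mulVec x i := by simp
      simp only [Matrix.mulVec_add, Matrix.mulVec_smul, dotProduct_add, add_dotProduct,
        smul_dotProduct, dotProduct_smul, smul_eq_mul, e1, e2, e3, ← hm] at h
      have : 0 ≤ t * (2 * (B.mulVec x i - m) + t * (m - 2 * B.mulVec x i + B i i)) := by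
        linarith
      exact nonneg_of_mul_nonneg_right this ht
    by_contra hlt
    push Not at hlt
    set d := m - B.mulVec x i with hd
    have hdp : 0 < d := by linarith
    set K := |m - 2 * B.mulVec x i + B i i| with hK
    have hKn : 0 ≤ K := abs_nonneg _
    have h1 := key (d / (d + K)) (by positivity) (by rw [div_le_one (by positivity)]; linarith)
    have h2 : d / (d + K) * (m - 2 * B.mulVec x i + B i i) ≤ d / (d + K) * K :=
      mul_le_mul_of_nonneg_left (le_abs_self _) (by positivity)
    have h3 : d / (d + K) * K ≤ d := by
      rw [div_mul_eq_mul_div, div_le_iff₀ (by positivity)]; nlinarith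
    linarith
  have hzero : ∀ i, x i * (B.mulVec x i - m) = 0 := by
    have hs : ∑ i, x i * (B.mulVec x i - m) = 0 := by
      simp only [mul_sub, Finset.sum_sub_distrib, ← Finset.sum_mul, hx.2]
      simp only [dotProduct] at hm
      linarith
    have := (Finset.sum_eq_zero_iff_of_nonneg
      (fun i _ => mul_nonneg (hx.1 i) (sub_nonneg.mpr (hge i)))).mp hs
    exact fun i => this i (mem_univ i)
  have hmpos : 0 < m := by
    have hp0 : p ≠ 0 := by linarith
    have hx0 : x ≠ 0 := by
      rintro rfl
      have := hx.2
      simp at this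
    have h := H (fun i => x i ^ (2 / p)) (fun i => Real.rpow_nonneg (hx.1 i) _) (by
      intro h0
      apply hx0
      funext i
      have := congrFun h0 i
      simp only [Pi.zero_apply] at this
      exact ((Real.rpow_eq_zero_iff_of_nonneg (hx.1 i)).mp this).1)
    have e : ∀ i, ∑ j, B i j * (x j ^ (2 / p)) ^ (p / 2) * (x i ^ (2 / p)) ^ (p / 2 - 1) * μ i
        = m * ((x i ^ (2 / p)) ^ (p / 2 - 1) * μ i) := by
      intro i
      have e1 : ∀ j, (x j ^ (2 / p)) ^ (p / 2) = x j := by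
        intro j
        rw [← Real.rpow_mul (hx.1 j), show 2 / p * (p / 2) = 1 by field_simp, Real.rpow_one]
      simp only [e1, mul_assoc]
      simp only [← mul_assoc (B i _)]
      rw [← Finset.sum_mul]
      rcases mul_eq_zero.mp (hzero i) with h0 | h0
      · rw [h0, Real.zero_rpow (by positivity), Real.zero_rpow (by linarith)]; simp
      · rw [show ∑ j, B i j * x j = B.mulVec x i from rfl, sub_eq_zero.mp h0]
    simp only [e, ← Finset.mul_sum] at h
    refine pos_of_mul_pos_left h (Finset.sum_nonneg fun i _ => mul_nonneg ?_ (hμ i))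
    exact Real.rpow_nonneg (Real.rpow_nonneg (hx.1 i) _) _
  have h := hmin' _ hcS
  rw [hQ]
  simp only [Matrix.mulVec_smul, smul_dotProduct, dotProduct_smul, smul_eq_mul] at h
  have hi : 0 < S⁻¹ := inv_pos.mpr hS
  have h' := hmpos.trans_le h
  exact pos_of_mul_pos_right (pos_of_mul_pos_right h' hi.le) hi.le
end

section
/- Let p > 2 and let B = (β_ij) be a symmetric 2×2 real matrix. If B is strictly copositive, then B is strictly (p−1)-copositive; in fact the vector μ = (β₁₁^{−1/p}, β₂₂^{−1/p}) satisfies ∑_{i,j=1}^2 β_ij c_j^{p/2} c_i^{p/2−1} μ_i > 0 for every c ∈ C⁺₂ with c ≠ 0. -/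
open Finset

lemma aux_core (a b d e : ℝ) (ha : 0 < a) (hb : -1 < b) (hd : 0 ≤ d) (he : 0 ≤ e)
    (hde : 0 < d ∨ 0 < e) :
    0 < (d ^ a) ^ 2 * d + (e ^ a) ^ 2 * e + b * (d ^ a * e ^ a * (d + e)) := by
  have hy : 0 ≤ d ^ a := Real.rpow_nonneg hd a
  have hz : 0 ≤ e ^ a := Real.rpow_nonneg he a
  have hS : 0 < (d ^ a) ^ 2 * d + (e ^ a) ^ 2 * e := by
    rcases hde with h | h
    · have := Real.rpow_pos_of_pos h a
      positivity
    · have := Real.rpow_pos_of_pos h a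
      positivity
  have hT : d ^ a * e ^ a * (d + e) ≤ (d ^ a) ^ 2 * d + (e ^ a) ^ 2 * e := by
    have : 0 ≤ (d ^ a - e ^ a) * (d ^ a * d - e ^ a * e) := by
      rcases le_total d e with h | h
      · have h1 := Real.rpow_le_rpow hd h ha.le
        have h2 := mul_le_mul h1 h hd hz
        exact mul_nonneg_of_nonpos_of_nonpos (by linarith) (by linarith)
      · have h1 := Real.rpow_le_rpow he h ha.le
        have h2 := mul_le_mul h1 h he hy
        exact mul_nonneg (by linarith) (by linarith)
    nlinarith
  have hT0 : 0 ≤ d ^ a * e ^ a * (d + e) := by positivity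
  generalize d ^ a * e ^ a * (d + e) = T at *
  generalize (d ^ a) ^ 2 * d + (e ^ a) ^ 2 * e = S at *
  rcases le_total 0 b with h | h
  · nlinarith
  · nlinarith [mul_le_mul_of_nonneg_left hT (neg_nonneg.2 h), mul_pos (by linarith : 0 < 1 + b) hS]

lemma aux_r (p β : ℝ) (hp : 2 < p) (hβ : 0 < β) :
    ∃ r q : ℝ, 0 < r ∧ 0 < q ∧ β = (q * r) ^ 2 ∧ β ^ (-(1 / p)) = r⁻¹ ∧ q = r ^ (p / 2 - 1) := by
  have hr : 0 < β ^ (1 / p) := Real.rpow_pos_of_pos hβ _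
  refine ⟨β ^ (1 / p), (β ^ (1 / p)) ^ (p / 2 - 1), hr, Real.rpow_pos_of_pos hr _, ?_,
    Real.rpow_neg hβ.le _, rfl⟩
  rw [← Real.rpow_add_one hr.ne', ← Real.rpow_mul hβ.le, ← Real.rpow_mul_natCast hβ.le]
  have : 1 / p * (p / 2 - 1 + 1) * ((2 : ℕ) : ℝ) = 1 := by
    have : p ≠ 0 := by linarith
    push_cast
    field_simp
    ring
  rw [this, Real.rpow_one]

theorem stmt_11 (p : ℝ) (hp : 2 < p)
    (B : Matrix (Fin 2) (Fin 2) ℝ) (hsym : B.IsSymm)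
    (hcop : ∀ c : Fin 2 → ℝ, (∀ i, 0 ≤ c i) → c ≠ 0 →
      0 < ∑ i, ∑ j, B i j * c i * c j) :
    (∃ μ : Fin 2 → ℝ, (∀ i, 0 ≤ μ i) ∧ ∀ c : Fin 2 → ℝ, (∀ i, 0 ≤ c i) → c ≠ 0 → 0 < ∑ i, ∑ j, B i j * c j ^ (p / 2) * c i ^ (p / 2 - 1) * μ i) ∧
    (∀ c : Fin 2 → ℝ, (∀ i, 0 ≤ c i) → c ≠ 0 →
      0 < ∑ i, ∑ j, B i j * c j ^ (p / 2) * c i ^ (p / 2 - 1) *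
        (![B 0 0 ^ (-(1 / p)), B 1 1 ^ (-(1 / p))] i)) := by
  have h10 : B 1 0 = B 0 1 := hsym.apply 0 1
  have h0 : 0 < B 0 0 := by
    have := hcop ![1, 0] (by intro i; fin_cases i <;> simp) (by intro h; simpa using congrFun h 0)
    simpa [Fin.sum_univ_two] using this
  have h1 : 0 < B 1 1 := by
    have := hcop ![0, 1] (by intro i; fin_cases i <;> simp) (by intro h; simpa using congrFun h 1)
    simpa [Fin.sum_univ_two] using this
  have key : ∀ c : Fin 2 → ℝ, (∀ i, 0 ≤ c i) → c ≠ 0 →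
      0 < ∑ i, ∑ j, B i j * c j ^ (p / 2) * c i ^ (p / 2 - 1) *
        (![B 0 0 ^ (-(1 / p)), B 1 1 ^ (-(1 / p))] i) := by
    intro c hc hne
    obtain ⟨r, q, hr, hq, hB0, hm0, hqr⟩ := aux_r p _ hp h0
    obtain ⟨r', q', hr', hq', hB1, hm1, hqr'⟩ := aux_r p _ hp h1
    obtain ⟨b, hb⟩ : ∃ b, B 0 1 = b * ((q * r) * (q' * r')) :=
      ⟨B 0 1 / ((q * r) * (q' * r')), by field_simp⟩
    have hb1 : -1 < b := by
      have := hcop ![q' * r', q * r] (by intro i; fin_cases i <;> simp <;> positivity)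
        (by
          intro h
          have h2 := congrFun h 0
          have : 0 < q' * r' := by positivity
          simp at h2
          rcases h2 with h2 | h2 <;> linarith)
      simp only [Fin.sum_univ_two, Matrix.cons_val_zero, Matrix.cons_val_one, h10, hB0, hB1, hb] at this
      have h3 : 0 < 2 * ((q * r) ^ 2 * (q' * r') ^ 2) * (1 + b) := by linarith
      have := pos_of_mul_pos_right h3 (by positivity)
      linarith
    have hpos : 0 < r * c 0 ∨ 0 < r' * c 1 := by
      by_contra hcon
      push Not at hcon
      apply hne
      ext i
      have e0 := nonpos_of_mul_nonpos_right hcon.1 hr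
      have e1 := nonpos_of_mul_nonpos_right hcon.2 hr'
      fin_cases i
      · exact le_antisymm e0 (hc 0)
      · exact le_antisymm e1 (hc 1)
    have main := aux_core (p / 2 - 1) b (r * c 0) (r' * c 1) (by linarith) hb1
      (mul_nonneg hr.le (hc 0)) (mul_nonneg hr'.le (hc 1)) hpos
    rw [Real.mul_rpow hr.le (hc 0), Real.mul_rpow hr'.le (hc 1), ← hqr, ← hqr'] at main
    have hx : ∀ i, c i ^ (p / 2) = c i ^ (p / 2 - 1) * c i := by
      intro i
      rw [← Real.rpow_add_one' (hc i) (by linarith)]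
      congr 1
      ring
    simp only [Fin.sum_univ_two, Matrix.cons_val_zero, Matrix.cons_val_one, h10, hm0, hm1, hx]
    rw [hB0, hB1, hb]
    convert main using 1
    field_simp
    ring
  refine ⟨⟨![B 0 0 ^ (-(1 / p)), B 1 1 ^ (-(1 / p))], ?_, key⟩, key⟩
  intro i
  fin_cases i
  · exact Real.rpow_nonneg h0.le _
  · exact Real.rpow_nonneg h1.le _
end
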